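/- arXiv:2212.01947 — 3 statements merged into one kernel-verified Lean document; each statement's English description precedes it below -/
import Mathlib

section
/- Fix n ≥ 1 and integers a₁, …, aₙ, and let ℂˣ act on ℂⁿ by t · (x₁, …, xₙ) = (t^{a₁} x₁, …, t^{aₙ} xₙ). Suppose x ∈ ℂⁿ is a point such that x_j ≠ 0 for some index j with a_j > 0 and x_k ≠ 0 for some index k with a_k < 0. Then the orbit { t · x : t ∈ ℂˣ } is a closed subset of ℂⁿ (in the standard topology) and the stabilizer { t ∈ ℂˣ : t · x = x } is finite. -/
/-- A bound on a positive power of `z` bounds `z` itself. -/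
theorem norm_le_of_norm_zpow_le {z : ℂ} {a : ℤ} (ha : 0 < a) {C : ℝ} (h : ‖z ^ a‖ ≤ C) :
    ‖z‖ ≤ max 1 C := by
  rcases le_total ‖z‖ 1 with hz | hz
  · exact le_max_of_le_left hz
  · refine le_max_of_le_right (le_trans ?_ h)
    rw [norm_zpow]
    simpa using zpow_le_zpow_right₀ hz (show (1 : ℤ) ≤ a by omega)

theorem exists_norm_zpow_le_of_tendsto {t : ℕ → ℂ} {a : ℤ} {c y : ℂ} (hc : c ≠ 0)
    (h : Filter.Tendsto (fun m => t m ^ a * c) Filter.atTop (nhds y)) :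
    ∃ C : ℝ, ∀ m, ‖t m ^ a‖ ≤ C := by
  have h' := h.mul_const c⁻¹
  simp only [mul_inv_cancel_right₀ hc] at h'
  obtain ⟨C, hC⟩ := (Metric.isBounded_range_of_tendsto _ h').exists_norm_le
  exact ⟨C, fun m => hC _ ⟨m, rfl⟩⟩

/-- For the action of `ℂˣ` on `ℂⁿ` given by `t · x = (t^{a 1} x 1, …, t^{a n} x n)`:
if `x` has a nonzero coordinate of strictly positive weight and a nonzero coordinate of
strictly negative weight, then the orbit of `x` is closed and the stabilizer of `x` is
finite (i.e. `x` is a stable point). -/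
theorem stable_point_of_pos_neg_weights (n : ℕ) (hn : 1 ≤ n) (a : Fin n → ℤ)
    (x : Fin n → ℂ) (j k : Fin n)
    (hj : 0 < a j) (hxj : x j ≠ 0) (hk : a k < 0) (hxk : x k ≠ 0) :
    IsClosed {y : Fin n → ℂ | ∃ t : ℂˣ, y = fun i => (t : ℂ) ^ (a i) * x i} ∧
      {t : ℂˣ | ∀ i, (t : ℂ) ^ (a i) * x i = x i}.Finite := by
  constructor
  · rw [← isSeqClosed_iff_isClosed]
    intro u y hu hy
    choose t ht using hu
    rw [tendsto_pi_nhds] at hy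
    simp only [ht] at hy
    obtain ⟨C, hC⟩ := exists_norm_zpow_le_of_tendsto hxj (hy j)
    obtain ⟨D, hD⟩ := exists_norm_zpow_le_of_tendsto hxk (hy k)
    have hbound : ∀ m, ((t m : ℂ), (t m : ℂ)⁻¹) ∈
        Metric.closedBall (0 : ℂ) (max 1 C) ×ˢ Metric.closedBall (0 : ℂ) (max 1 D) := by
      intro m
      simp only [Set.mem_prod, mem_closedBall_zero_iff]
      exact ⟨norm_le_of_norm_zpow_le hj (hC m),
        norm_le_of_norm_zpow_le (neg_pos.mpr hk) (by simpa using hD m)⟩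
    obtain ⟨⟨s, s'⟩, -, φ, hφ, hs⟩ :=
      ((isCompact_closedBall _ _).prod (isCompact_closedBall _ _)).tendsto_subseq hbound
    rw [Prod.tendsto_iff] at hs
    obtain ⟨hs, hs'⟩ := hs
    have hmul : s * s' = 1 := by
      refine tendsto_nhds_unique (hs.mul hs') ?_
      simp
    have hs0 : s ≠ 0 := left_ne_zero_of_mul_eq_one hmul
    refine ⟨Units.mk0 s hs0, funext fun i => ?_⟩
    exact tendsto_nhds_unique ((hy i).comp hφ.tendsto_atTop)
      ((hs.zpow₀ (a i) (Or.inl hs0)).mul_const (x i))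
  · have : NeZero (a j).toNat := ⟨by omega⟩
    have hfin : (rootsOfUnity (a j).toNat ℂ : Set ℂˣ).Finite :=
      Set.finite_coe_iff.mp (inferInstanceAs (Finite (rootsOfUnity (a j).toNat ℂ)))
    refine hfin.subset fun t ht => ?_
    have h1 : (t : ℂ) ^ a j = 1 := mul_right_cancel₀ hxj (by simpa using ht j)
    rw [SetLike.mem_coe, mem_rootsOfUnity', ← zpow_natCast, Int.toNat_of_nonneg hj.le, h1]
end

section
/- Fix n ≥ 1 and integers a₁, …, aₙ, and let ℂˣ act on ℂⁿ by t · (x₁, …, xₙ) = (t^{a₁} x₁, …, t^{aₙ} xₙ). If all the weights have the same sign, i.e. either aᵢ ≥ 0 for every i or aᵢ ≤ 0 for every i, then no point x ∈ ℂⁿ has both a closed orbit { t · x : t ∈ ℂˣ } (in the standard topology of ℂⁿ) and a finite stabilizer { t ∈ ℂˣ : t · x = x }. -/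
/-- If all weights are nonnegative and the orbit of `x` is closed, then it contains the limit of
`t · x` as `t → 0`, so `x` is supported on the coordinates of weight zero. -/
theorem eq_zero_of_isClosed_orbit {n : ℕ} {a : Fin n → ℤ} (ha : ∀ i, 0 ≤ a i) {x : Fin n → ℂ}
    (hx : IsClosed {y : Fin n → ℂ | ∃ t : ℂˣ, y = fun i => (t : ℂ) ^ (a i) * x i})
    {i : Fin n} (hi : a i ≠ 0) : x i = 0 := by
  have hcont : Continuous fun (s : ℂ) (j : Fin n) => s ^ (a j) * x j :=
    continuous_pi fun j => (continuous_id.zpow₀ (a j) fun _ => Or.inr (ha j)).mul continuous_const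
  have hmem := hx.mem_of_tendsto ((hcont.tendsto 0).mono_left (nhdsWithin_le_nhds (s := {0}ᶜ)))
    (Filter.eventually_of_mem self_mem_nhdsWithin fun s hs => ⟨Units.mk0 s hs, rfl⟩)
  obtain ⟨t, ht⟩ := hmem
  have hti : (0 : ℂ) ^ (a i) * x i = (t : ℂ) ^ (a i) * x i := congrFun ht i
  rw [zero_zpow _ hi, zero_mul] at hti
  exact (mul_eq_zero.mp hti.symm).resolve_left (zpow_ne_zero _ t.ne_zero)

/-- Negating all weights does not change the orbit. -/
theorem orbit_neg_weights {n : ℕ} (a : Fin n → ℤ) (x : Fin n → ℂ) :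
    {y : Fin n → ℂ | ∃ t : ℂˣ, y = fun i => (t : ℂ) ^ (-a i) * x i} =
      {y : Fin n → ℂ | ∃ t : ℂˣ, y = fun i => (t : ℂ) ^ (a i) * x i} := by
  ext y
  exact (Equiv.inv ℂˣ).exists_congr fun t => by simp

/-- For the action of `ℂˣ` on `ℂⁿ` given by `t · x = (t^{a 1} x 1, …, t^{a n} x n)`:
if all the weights have the same sign, then no point has both a closed orbit and a
finite stabilizer (the stable locus is empty). -/
theorem no_stable_point_of_same_sign_weights (n : ℕ) (hn : 1 ≤ n) (a : Fin n → ℤ)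
    (ha : (∀ i, 0 ≤ a i) ∨ (∀ i, a i ≤ 0)) (x : Fin n → ℂ) :
    ¬ (IsClosed {y : Fin n → ℂ | ∃ t : ℂˣ, y = fun i => (t : ℂ) ^ (a i) * x i} ∧
        {t : ℂˣ | ∀ i, (t : ℂ) ^ (a i) * x i = x i}.Finite) := by
  rintro ⟨hclosed, hfin⟩
  have hsupp : ∀ i, a i ≠ 0 → x i = 0 := by
    intro i hi
    rcases ha with ha | ha
    · exact eq_zero_of_isClosed_orbit ha hclosed hi
    · rw [← orbit_neg_weights] at hclosed
      exact eq_zero_of_isClosed_orbit (fun j => neg_nonneg.mpr (ha j)) hclosed (neg_ne_zero.mpr hi)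
  have huniv : {t : ℂˣ | ∀ i, (t : ℂ) ^ (a i) * x i = x i} = Set.univ := by
    refine Set.eq_univ_of_forall fun t i => ?_
    by_cases hi : a i = 0
    · simp [hi]
    · simp [hsupp i hi]
  rw [huniv] at hfin
  have : Infinite ℂˣ := Infinite.of_injective
    (fun k : ℕ => Units.mk0 ((k : ℂ) + 1) k.cast_add_one_ne_zero) fun k l h => by
      simpa using congrArg Units.val h
  exact Set.infinite_univ hfin
end

section
/- Fix n ≥ 1 and integers a₁, …, aₙ such that a_j > 0 and a_k < 0 for some indices j, k. Give the polynomial ring R = ℂ[x₁, …, xₙ] the ℤ-grading in which the monomial x₁^{m₁} ⋯ xₙ^{mₙ} has degree a₁m₁ + ⋯ + aₙmₙ, and let R₀ be the degree-zero subring of R. Then R₀ is a Noetherian ring and is Cohen–Macaulay, i.e. for every prime ideal p of R₀ the local ring (R₀)_p is a Cohen–Macaulay local ring. -/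
open CategoryTheory Opposite MvPolynomial

set_option synthInstance.maxHeartbeats 1000000
set_option maxHeartbeats 1000000

/-- The `n`-th Ext module `Ext_R^n(A, B)` of two `R`-modules `A` and `B`. -/
noncomputable def extModule (R : Type) [CommRing R] (n : ℕ)
    (A B : Type) [AddCommGroup A] [Module R A] [AddCommGroup B] [Module R B] :
    ModuleCat R :=
  ((Ext R (ModuleCat R) n).obj (op (ModuleCat.of R A))).obj (ModuleCat.of R B)

/-- The depth of a module `P` over a local ring `(R, m, k)`:
`depth_R P = inf { i : Ext_R^i(k, P) ≠ 0 }`, as an element of `ℕ∞`. -/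
noncomputable def moduleDepth (R : Type) [CommRing R] [IsLocalRing R]
    (P : Type) [AddCommGroup P] [Module R P] : ℕ∞ :=
  sInf {i : ℕ∞ | ∃ n : ℕ, i = n ∧
    Nontrivial (extModule R n (IsLocalRing.ResidueField R) P)}

/-- A Noetherian local ring is Cohen–Macaulay if its depth equals its Krull dimension. -/
def IsCohenMacaulayLocalRing (R : Type) [CommRing R] [IsLocalRing R] : Prop :=
  (moduleDepth R R : WithBot ℕ∞) = ringKrullDim R

/-- The submodules of weighted homogeneous polynomials form a graded monoid. -/
instance (n : ℕ) (a : Fin n → ℤ) :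
    SetLike.GradedMonoid (weightedHomogeneousSubmodule ℂ a) :=
  WeightedHomogeneousSubmodule.gradedMonoid

/-- The degree-zero subring `R₀` of `ℂ[x₁, …, xₙ]` for the `ℤ`-grading in which the
monomial `x₁^{m₁} ⋯ xₙ^{mₙ}` has degree `a₁ m₁ + ⋯ + aₙ mₙ`. -/
noncomputable def degreeZeroSubring (n : ℕ) (a : Fin n → ℤ) :
    Subalgebra ℂ (MvPolynomial (Fin n) ℂ) :=
  SetLike.GradeZero.subalgebra (weightedHomogeneousSubmodule ℂ a)

theorem subsingleton_abelianExt_iff {R : Type} [CommRing R] (X Y : ModuleCat.{0} R) (n : ℕ) :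
    Subsingleton (Abelian.Ext X Y n) ↔
      Subsingleton (((Ext R (ModuleCat.{0} R) n).obj (op X)).obj Y) := by
  let P := projectiveResolution X
  rw [← ModuleCat.isZero_iff_subsingleton, (P.isoExt n Y).isZero_iff,
    ← HomologicalComplex.exactAt_iff_isZero_homology]
  rcases n with _ | p
  · rw [HomologicalComplex.exactAt_iff' _ 0 0 1 (by simp) (by simp),
      ShortComplex.moduleCat_exact_iff, Abelian.Ext.addEquiv₀.toEquiv.subsingleton_congr]
    obtain ⟨π, hπ, hex, hepi⟩ : ∃ (π : P.complex.X 0 ⟶ X) (hπ : P.complex.d 1 0 ≫ π = 0),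
        (ShortComplex.mk _ _ hπ).Exact ∧ Epi π :=
      ⟨P.π.f 0, P.complex_d_comp_π_f_zero, P.exact₀,
        inferInstanceAs (Epi (P.π.f 0))⟩
    have : Epi (ShortComplex.mk _ _ hπ).g := hepi
    constructor
    · intro h (f : P.complex.X 0 ⟶ Y) (hf : P.complex.d 1 0 ≫ f = 0)
      refine ⟨0, ?_⟩
      rw [map_zero, ← hex.g_desc f hf]
      rw [show hex.desc f hf = 0 from Subsingleton.elim (α := X ⟶ Y) _ _]
      exact Limits.comp_zero.symm
    · refine fun h ↦ subsingleton_of_forall_eq 0 fun g ↦ ?_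
      obtain ⟨x, hx⟩ := h (π ≫ g) (show P.complex.d 1 0 ≫ π ≫ g = 0 by
        rw [← Category.assoc, hπ, Limits.zero_comp])
      have hz : π ≫ g = 0 := by
        rw [← hx]
        have : (P.complex.linearYonedaObj R Y).d 0 0 = 0 :=
          HomologicalComplex.shape _ _ _ (by simp)
        change (P.complex.linearYonedaObj R Y).d 0 0 x = 0
        rw [this]; rfl
      rwa [← cancel_epi π, Limits.comp_zero]
  · rw [HomologicalComplex.exactAt_iff' _ p (p+1) (p+2) (by simp) (by simp),
      ShortComplex.moduleCat_exact_iff]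
    constructor
    · intro h (f : P.complex.X (p+1) ⟶ Y) (hf : P.complex.d (p+2) (p+1) ≫ f = 0)
      obtain ⟨g, hg⟩ := (P.extMk_eq_zero_iff f (p+2) rfl hf p rfl).1 (Subsingleton.elim _ _)
      exact ⟨g, hg⟩
    · refine fun h ↦ subsingleton_of_forall_eq 0 fun α ↦ ?_
      obtain ⟨f, hf, rfl⟩ := P.extMk_surjective α (p+2) rfl
      obtain ⟨g, hg⟩ := h f hf
      exact (P.extMk_eq_zero_iff f (p+2) rfl hf p rfl).2 ⟨g, hg⟩

open IsLocalRing RingTheory.Sequence in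
theorem IsLocalRing.exists_mem_forall_notMem_minimalPrimes {R : Type*} [CommRing R]
    [IsLocalRing R] [IsNoetherianRing R] (h : 0 < ringKrullDim R) :
    ∃ x ∈ maximalIdeal R, x ∉ maximalIdeal R ^ 2 ∧ ∀ P ∈ minimalPrimes R, x ∉ P := by
  by_contra! H
  have hsub : (maximalIdeal R : Set R) ⊆
      ⋃ I ∈ insert (maximalIdeal R ^ 2) (minimalPrimes R), (id I : Ideal R) := by
    intro x hx
    by_cases h2 : x ∈ maximalIdeal R ^ 2
    · exact Set.mem_biUnion (Set.mem_insert _ _) h2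
    · obtain ⟨P, hP, hxP⟩ := H x hx h2
      exact Set.mem_biUnion (Set.mem_insert_of_mem _ hP) hxP
  have hht : 0 < (maximalIdeal R).height := by
    rw [← maximalIdeal_height_eq_ringKrullDim] at h
    exact_mod_cast h
  obtain ⟨I, hI, hle⟩ := (Ideal.subset_union_prime_finite
    ((minimalPrimes.finite_of_isNoetherianRing R).insert _)
    (maximalIdeal R ^ 2) (maximalIdeal R ^ 2)
    (fun i hi h2 _ ↦ ((Set.mem_insert_iff.1 hi).resolve_left h2).1.1)).1 hsub
  rcases Set.mem_insert_iff.1 hI with rfl | hI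
  · have : maximalIdeal R = ⊥ := Submodule.eq_bot_of_le_smul_of_le_jacobson_bot (maximalIdeal R) _
      (IsNoetherian.noetherian _) (by simpa [pow_two] using hle)
      (maximalIdeal_le_jacobson _)
    exact h.ne' (ringKrullDim_eq_zero_of_isField (isField_iff_maximalIdeal_eq.2 this))
  · have hp : I.IsPrime := hI.1.1
    obtain rfl : I = maximalIdeal R := le_antisymm (le_maximalIdeal hp.ne_top) hle
    exact hht.ne' (Ideal.height_eq_zero_iff.2 hI)

open IsLocalRing RingTheory.Sequence in
theorem IsLocalRing.exists_span_insert_eq_maximalIdeal {R : Type*} [CommRing R]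
    [IsLocalRing R] {s : Finset R} (hs : Ideal.span (s : Set R) = maximalIdeal R) {x : R}
    (hx : x ∈ maximalIdeal R) (hx2 : x ∉ maximalIdeal R ^ 2) :
    ∃ t : Finset R, t.card < s.card ∧ Ideal.span (insert x (t : Set R)) = maximalIdeal R := by
  classical
  rw [← hs, Submodule.mem_span_finset] at hx
  obtain ⟨c, -, rfl⟩ := hx
  have hsm : ∀ y ∈ s, y ∈ maximalIdeal R := fun y hy ↦ hs ▸ Ideal.subset_span hy
  obtain ⟨y, hy, hc⟩ : ∃ y ∈ s, IsUnit (c y) := by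
    by_contra! H
    refine hx2 (Ideal.sum_mem _ fun y hy ↦ ?_)
    rw [pow_two]
    exact Ideal.mul_mem_mul ((mem_maximalIdeal _).2 (H y hy)) (hsm y hy)
  refine ⟨s.erase y, Finset.card_erase_lt_of_mem hy, le_antisymm ?_ ?_⟩
  · rw [Ideal.span_le]
    rintro z (rfl | hz)
    · exact Ideal.sum_mem _ fun y hy ↦ Ideal.mul_mem_left _ _ (hsm y hy)
    · exact hsm z (Finset.mem_of_mem_erase hz)
  · rw [← hs, Ideal.span_le]
    intro z hz
    have hmem : ∀ w ∈ s.erase y,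
        w ∈ Ideal.span (insert (∑ a ∈ s, c a • a) ((s.erase y : Finset R) : Set R)) :=
      fun w hw ↦ Ideal.subset_span (Set.mem_insert_of_mem _ hw)
    by_cases hzy : z = y
    · subst hzy
      have h1 : c z • z ∈ Ideal.span (insert (∑ a ∈ s, c a • a) ((s.erase z : Finset R) : Set R)) := by
        rw [← Finset.add_sum_erase s _ hz] at *
        have h2 := Ideal.sub_mem _ (Ideal.subset_span (Set.mem_insert (c z • z + ∑ a ∈ s.erase z, c a • a) _))
          (Ideal.sum_mem _ fun w hw ↦ Ideal.mul_mem_left _ (c w) (hmem w hw))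
        simpa using h2
      exact (Ideal.unit_mul_mem_iff_mem _ hc).1 h1
    · exact hmem z (Finset.mem_erase.2 ⟨hzy, hz⟩)

open Pointwise IsLocalRing RingTheory.Sequence in
theorem IsLocalRing.isDomain_and_exists_isWeaklyRegular (d : ℕ) {R : Type} [CommRing R]
    [IsLocalRing R] [IsNoetherianRing R] (hd : (d : WithBot ℕ∞) ≤ ringKrullDim R)
    (s : Finset R) (hs : Ideal.span (s : Set R) = maximalIdeal R) (hcard : s.card ≤ d) :
    IsDomain R ∧ ∃ rs : List R, rs.length = d ∧ (∀ r ∈ rs, r ∈ maximalIdeal R) ∧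
      IsWeaklyRegular R rs := by
  induction d generalizing R with
  | zero =>
    obtain rfl : s = ∅ := by simpa using hcard
    have hf : IsField R := by
      rw [isField_iff_maximalIdeal_eq, ← hs]; simp
    exact ⟨hf.isDomain, [], rfl, by simp, .nil _ _⟩
  | succ d ih =>
    obtain ⟨x, hx, hx2, hxP⟩ := exists_mem_forall_notMem_minimalPrimes (R := R)
      (lt_of_lt_of_le (by exact_mod_cast d.succ_pos) hd)
    obtain ⟨t, htcard, ht⟩ := exists_span_insert_eq_maximalIdeal hs hx hx2
    have hne : Ideal.span {x} ≠ ⊤ := fun h ↦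
      (maximalIdeal.isMaximal R).ne_top (top_le_iff.1 (h ▸ (Ideal.span_singleton_le_iff_mem _).2 hx))
    have : Nontrivial (R ⧸ Ideal.span {x}) := Ideal.Quotient.nontrivial_iff.2 hne
    have : IsLocalRing (R ⧸ Ideal.span {x}) :=
      .of_surjective' (Ideal.Quotient.mk _) Ideal.Quotient.mk_surjective
    have : IsLocalHom (Ideal.Quotient.mk (Ideal.span {x})) :=
      .of_surjective _ Ideal.Quotient.mk_surjective
    classical
    obtain ⟨hdom, rs, hlen, hmem, hreg⟩ := ih (R := R ⧸ Ideal.span {x}) (by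
        have h1 := ringKrullDim_le_ringKrullDim_quotient_add_card {x}
          (by simpa [ringJacobson_eq_maximalIdeal] using hx)
        rw [Finset.coe_singleton, Finset.card_singleton] at h1
        have h3 := hd.trans h1
        push_cast at h3
        exact ENat.WithBot.add_le_add_one_right_iff.1 h3)
      (t.image (Ideal.Quotient.mk _)) (by
        have : Ideal.map (Ideal.Quotient.mk (Ideal.span {x})) (maximalIdeal R) =
            maximalIdeal (R ⧸ Ideal.span {x}) := by
          refine (map_maximalIdeal_le _).antisymm fun y hy ↦ ?_
          obtain ⟨y, rfl⟩ := Ideal.Quotient.mk_surjective y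
          exact Ideal.mem_map_of_mem _ ((mem_maximalIdeal _).2 fun h ↦
            (mem_maximalIdeal _).1 hy (h.map _))
        rw [← this, ← ht, Ideal.map_span, Set.image_insert_eq,
          (Ideal.Quotient.eq_zero_iff_mem).2 (Ideal.mem_span_singleton_self x)]
        simp)
      (Finset.card_image_le.trans (by omega))
    have hxprime : (Ideal.span {x}).IsPrime := (Ideal.Quotient.isDomain_iff_prime _).1 hdom
    have hbot : (⊥ : Ideal R).IsPrime := by
      obtain ⟨P, hP, hPx⟩ := Ideal.exists_minimalPrimes_le (bot_le (a := Ideal.span {x}))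
      have hPp : P.IsPrime := hP.1.1
      have : P = ⊥ := Submodule.eq_bot_of_le_smul_of_le_jacobson_bot (maximalIdeal R) _
        (IsNoetherian.noetherian _) (fun y hy ↦ by
          obtain ⟨z, rfl⟩ := Ideal.mem_span_singleton'.1 (hPx hy)
          rw [smul_eq_mul, mul_comm z x]
          exact Ideal.mul_mem_mul hx ((hPp.mem_or_mem hy).resolve_right (hxP P hP)))
        (maximalIdeal_le_jacobson _)
      exact this ▸ hPp
    have hR : IsDomain R := IsDomain.of_bot_isPrime R
    have hx0 : x ≠ 0 := fun h ↦ hx2 (h ▸ zero_mem _)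
    choose f hf using Ideal.Quotient.mk_surjective (I := Ideal.span {x})
    refine ⟨hR, x :: rs.map f, by simpa using hlen, ?_, ?_⟩
    · simp only [List.mem_cons, List.mem_map, forall_eq_or_imp, hx, true_and]
      rintro _ ⟨r, hr, rfl⟩
      have := hmem r hr
      rw [← hf r] at this
      rw [mem_maximalIdeal, mem_nonunits_iff] at this ⊢
      exact fun h ↦ this (h.map _)
    · rw [isWeaklyRegular_cons_iff']
      refine ⟨fun _ _ h ↦ mul_left_cancel₀ hx0 h, ?_⟩
      have h1 : (rs.map f).map (Ideal.Quotient.mk (Ideal.span {x})) = rs := by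
        rw [List.map_map]
        exact (List.map_congr_left fun r _ ↦ hf r).trans (List.map_id _)
      rw [h1]
      let e : (R ⧸ Ideal.span {x}) ≃ₗ[R] QuotSMulTop x R :=
        Submodule.quotEquivOfEq _ _ (by simp [← Submodule.ideal_span_singleton_smul])
      refine (e.toAddEquiv.isWeaklyRegular_congr (List.forall₂_same.2 fun r _ y ↦ ?_)).1 hreg
      obtain ⟨r, rfl⟩ := Ideal.Quotient.mk_surjective r
      exact e.map_smul r y

open IsLocalRing RingTheory.Sequence in
theorem isCohenMacaulayLocalRing_of_isRegular {R : Type} [CommRing R] [IsLocalRing R]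
    [IsNoetherianRing R] {rs : List R} (hmem : ∀ r ∈ rs, r ∈ maximalIdeal R)
    (hreg : IsRegular R rs) (hdim : ringKrullDim R ≤ rs.length) :
    IsCohenMacaulayLocalRing R := by
  have hle (l : List R) (hl : IsRegular R l) : (l.length : WithBot ℕ∞) ≤ ringKrullDim R := by
    rw [← ringKrullDim_add_length_eq_ringKrullDim_of_isRegular l hl]
    have : Nontrivial (R ⧸ Ideal.ofList l) := Ideal.Quotient.nontrivial_iff.2 fun h ↦
      hl.top_ne_smul (by rw [h]; simp)
    exact le_add_of_nonneg_left ringKrullDim_nonneg_of_nontrivial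
  have hdim' := le_antisymm hdim (hle rs hreg)
  have hsub (i : ℕ) : Subsingleton (extModule R i (ResidueField R) R) ↔
      Subsingleton (Abelian.Ext (ModuleCat.of R (ResidueField R)) (ModuleCat.of R R) i) :=
    (subsingleton_abelianExt_iff _ _ _).symm
  have hsupp : Module.support R (ResidueField R) = PrimeSpectrum.zeroLocus (maximalIdeal R) := by
    have : Module.annihilator R (ResidueField R) = maximalIdeal R := Ideal.annihilator_quotient
    rw [Module.support_eq_zeroLocus, this]
  have hlt : maximalIdeal R • (⊤ : Submodule R (ModuleCat.of R R)) < ⊤ := by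
    simpa using (maximalIdeal.isMaximal R).ne_top.lt_top
  have hlow : ∀ i < rs.length, Subsingleton (extModule R i (ResidueField R) R) := fun i hi ↦
    (hsub i).2 (ModuleCat.subsingleton_ext_of_exists_isRegular (maximalIdeal R)
      (ModuleCat.of R (ResidueField R)) hsupp.le (ModuleCat.of R R) hlt rs hmem hreg i hi)
  have htop : Nontrivial (extModule R rs.length (ResidueField R) R) := by
    by_contra h
    rw [not_nontrivial_iff_subsingleton] at h
    obtain ⟨l, hl, -, hlreg⟩ := ModuleCat.exists_isRegular_of_exists_subsingleton_ext
      (maximalIdeal R) (rs.length + 1) (ModuleCat.of R R) hlt (ModuleCat.of R (ResidueField R))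
      hsupp (fun i hi ↦ (hsub i).1 ((Nat.lt_succ_iff_lt_or_eq.1 hi).elim (hlow i) (· ▸ h)))
    have := (hle l hlreg).trans hdim
    rw [hl] at this
    exact absurd this (by norm_cast; omega)
  rw [IsCohenMacaulayLocalRing, hdim', moduleDepth]
  have : IsLeast {i : ℕ∞ | ∃ n : ℕ, i = n ∧ Nontrivial (extModule R n (ResidueField R) R)}
      rs.length := by
    refine ⟨⟨_, rfl, htop⟩, ?_⟩
    rintro _ ⟨i, rfl, hi⟩
    by_contra! h
    exact not_nontrivial_iff_subsingleton.2 (hlow i (by exact_mod_cast h)) hi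
  rw [this.csInf_eq]
  rfl

open IsLocalRing RingTheory.Sequence in
theorem Module.Finite.ringKrullDim_localization_le_height_under (S : Type*) {A : Type*}
    [CommRing S] [CommRing A] [Algebra S A] [Module.Finite S A] (p : Ideal A) [p.IsPrime] :
    ringKrullDim (Localization.AtPrime p) ≤ (p.under S).height := by
  rw [IsLocalization.AtPrime.ringKrullDim_eq_height p]
  refine WithBot.coe_le_coe.2 ?_
  have hmono : StrictMono (PrimeSpectrum.comap (algebraMap S A)) := fun I J hIJ ↦
    Ideal.IsIntegral.comap_lt_comap (R := S) hIJ
  have h := Order.height_le_height_apply_of_strictMono _ hmono ⟨p, inferInstance⟩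
  rwa [← PrimeSpectrum.height_eq_orderHeight, ← PrimeSpectrum.height_eq_orderHeight] at h

open IsLocalRing RingTheory.Sequence in
theorem isCohenMacaulayLocalRing_of_finite_of_flat (S : Type) {A : Type} [CommRing S] [CommRing A]
    [Algebra S A] [IsRegularRing S] [Module.Finite S A] [Module.Flat S A] (p : Ideal A)
    [p.IsPrime] : IsCohenMacaulayLocalRing (Localization.AtPrime p) := by
  have : IsNoetherianRing A := IsNoetherianRing.of_finite S A
  have : IsNoetherianRing (Localization.AtPrime p) :=
    IsLocalization.isNoetherianRing p.primeCompl _ inferInstance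
  let := Localization.AtPrime.algebraOfLiesOver (p.under S) p
  have hloc : IsLocalHom
      (algebraMap (Localization.AtPrime (p.under S)) (Localization.AtPrime p)) := by
    rw [RingHom.algebraMap_toAlgebra]
    exact Localization.isLocalHom_localRingHom (p.under S) p (algebraMap S A) Ideal.LiesOver.over
  have hreg : IsRegularLocalRing (Localization.AtPrime (p.under S)) :=
    IsRegularRing.isRegularLocalRing_localization _
  have hdim := IsRegularLocalRing.spanFinrank_maximalIdeal
    (R := Localization.AtPrime (p.under S))
  have hfg := IsNoetherian.noetherian (maximalIdeal (Localization.AtPrime (p.under S)))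
  obtain ⟨-, rs, hlen, hmem, hreg⟩ := isDomain_and_exists_isWeaklyRegular _ hdim.le
    hfg.finite_generators.toFinset (by
      rw [Set.Finite.coe_toFinset]
      exact Submodule.span_generators _)
    (by rw [← Set.ncard_eq_toFinset_card _ hfg.finite_generators, hfg.generators_ncard])
  have hmem' : ∀ r ∈ rs.map (algebraMap _ (Localization.AtPrime p)),
      r ∈ maximalIdeal (Localization.AtPrime p) := by
    simp only [List.mem_map, forall_exists_index, and_imp]
    rintro _ r hr rfl
    exact (mem_maximalIdeal _).2 fun h ↦ (mem_maximalIdeal _).1 (hmem r hr) (hloc.map_nonunit _ h)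
  refine isCohenMacaulayLocalRing_of_isRegular hmem'
    ((isRegular_iff_isWeaklyRegular_of_subset_maximalIdeal hmem').2 hreg.of_flat) ?_
  rw [List.length_map, hlen, hdim,
    IsLocalization.AtPrime.ringKrullDim_eq_height (p.under S) (Localization.AtPrime (p.under S))]
  exact Module.Finite.ringKrullDim_localization_le_height_under S p

namespace MvPolynomial

variable {σ : Type*}

open Classical in
/-- The algebra endomorphism of `ℂ[σ]` setting all variables outside of `V` to zero. -/
noncomputable def killOutside (V : Set σ) : MvPolynomial σ ℂ →ₐ[ℂ] MvPolynomial σ ℂ :=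
  aeval fun i ↦ if i ∈ V then X i else 0

theorem killOutside_X_of_mem {V : Set σ} {i : σ} (h : i ∈ V) : killOutside V (X i) = X i := by
  simp [killOutside, h]

theorem killOutside_X_of_notMem {V : Set σ} {i : σ} (h : i ∉ V) : killOutside V (X i) = 0 := by
  simp [killOutside, h]

theorem killOutside_univ : killOutside (Set.univ : Set σ) = AlgHom.id ℂ _ := by
  ext i; simp [killOutside]

theorem killOutside_killOutside {U V : Set σ} (h : U ⊆ V) (f : MvPolynomial σ ℂ) :
    killOutside U (killOutside V f) = killOutside U f := by
  suffices (killOutside U).comp (killOutside V) = killOutside U from DFunLike.congr_fun this f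
  refine algHom_ext fun i ↦ ?_
  by_cases hV : i ∈ V
  · simp [killOutside_X_of_mem hV]
  · simp [killOutside_X_of_notMem hV, killOutside_X_of_notMem fun hU ↦ hV (h hU)]

theorem killOutside_monomial_of_subset {V : Set σ} {μ : σ →₀ ℕ} (h : ↑μ.support ⊆ V) (r : ℂ) :
    killOutside V (monomial μ r) = monomial μ r := by
  rw [killOutside, aeval_monomial, monomial_eq]
  congr 1
  refine Finsupp.prod_congr fun i hi ↦ ?_
  rw [if_pos (h hi)]

theorem killOutside_monomial_of_notMem {V : Set σ} {μ : σ →₀ ℕ} {i : σ} (hi : i ∈ μ.support)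
    (h : i ∉ V) (r : ℂ) : killOutside V (monomial μ r) = 0 := by
  rw [killOutside, aeval_monomial, Finsupp.prod, Finset.prod_eq_zero hi, mul_zero]
  rw [if_neg h, zero_pow (Finsupp.mem_support_iff.1 hi)]

theorem coeff_killOutside_of_subset {V : Set σ} {ν : σ →₀ ℕ} (h : ↑ν.support ⊆ V)
    (f : MvPolynomial σ ℂ) : coeff ν (killOutside V f) = coeff ν f := by
  classical
  induction f using MvPolynomial.induction_on' with
  | monomial μ r =>
    by_cases hμ : ↑μ.support ⊆ V
    · rw [killOutside_monomial_of_subset hμ]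
    · obtain ⟨i, hi, hiV⟩ := Set.not_subset.1 hμ
      rw [killOutside_monomial_of_notMem hi hiV, coeff_zero, coeff_monomial, if_neg]
      rintro rfl
      exact hμ h
  | add p q hp hq => simp [hp, hq]

theorem coeff_killOutside_of_notMem {V : Set σ} {ν : σ →₀ ℕ} {i : σ} (hi : i ∈ ν.support)
    (h : i ∉ V) (f : MvPolynomial σ ℂ) : coeff ν (killOutside V f) = 0 := by
  classical
  induction f using MvPolynomial.induction_on' with
  | monomial μ r =>
    by_cases hμ : ↑μ.support ⊆ V
    · rw [killOutside_monomial_of_subset hμ, coeff_monomial, if_neg]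
      rintro rfl
      exact h (hμ hi)
    · obtain ⟨i, hi, hiV⟩ := Set.not_subset.1 hμ
      rw [killOutside_monomial_of_notMem hi hiV, coeff_zero]
  | add p q hp hq => simp [hp, hq]

theorem killOutside_killOutside_of_superset {U V : Set σ} (h : U ⊆ V) (f : MvPolynomial σ ℂ) :
    killOutside V (killOutside U f) = killOutside U f := by
  suffices (killOutside V).comp (killOutside U) = killOutside U from DFunLike.congr_fun this f
  refine algHom_ext fun i ↦ ?_
  by_cases hU : i ∈ U
  · simp [killOutside_X_of_mem hU, killOutside_X_of_mem (h hU)]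
  · simp [killOutside_X_of_notMem hU]

theorem X_dvd_killOutside_sub_killOutside (V : Set σ) (u : σ) (f : MvPolynomial σ ℂ) :
    X u ∣ killOutside V f - killOutside (V \ {u}) f := by
  classical
  induction f using MvPolynomial.induction_on' with
  | monomial μ r =>
    by_cases hμ : ↑μ.support ⊆ V
    · rw [killOutside_monomial_of_subset hμ]
      by_cases hu : u ∈ μ.support
      · rw [killOutside_monomial_of_notMem hu (by simp), sub_zero, X_dvd_monomial]
        exact .inr (Finsupp.mem_support_iff.1 hu)
      · rw [killOutside_monomial_of_subset, sub_self]
        · exact dvd_zero _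
        · exact fun i hi ↦ ⟨hμ hi, fun h ↦ hu (h ▸ hi)⟩
    · obtain ⟨i, hi, hiV⟩ := Set.not_subset.1 hμ
      rw [killOutside_monomial_of_notMem hi hiV, killOutside_monomial_of_notMem hi fun h ↦ hiV h.1,
        sub_self]
      exact dvd_zero _
  | add p q hp hq =>
    rw [map_add, map_add, add_sub_add_comm]
    exact dvd_add hp hq

theorem eq_zero_of_forall_X_pow_dvd {f : MvPolynomial σ ℂ} (t : σ) (h : ∀ N : ℕ, X t ^ N ∣ f) :
    f = 0 := by
  by_contra hf
  obtain ⟨g, hg⟩ := h (f.totalDegree + 1)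
  have hg0 : g ≠ 0 := by rintro rfl; simp [hf] at hg
  have := congr_arg totalDegree hg
  rw [totalDegree_mul_of_isDomain (pow_ne_zero _ (X_ne_zero t)) hg0, totalDegree_X_pow] at this
  omega

theorem IsWeightedHomogeneous.killOutside {M : Type*} [AddCommMonoid M] {w : σ → M} {m : M}
    {f : MvPolynomial σ ℂ} (hf : IsWeightedHomogeneous w f m) (V : Set σ) :
    IsWeightedHomogeneous w (killOutside V f) m := by
  intro ν hν
  refine hf (fun h ↦ hν ?_)
  by_cases hs : ↑ν.support ⊆ V
  · rw [coeff_killOutside_of_subset hs, h]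
  · obtain ⟨i, hi, hiV⟩ := Set.not_subset.1 hs
    rw [coeff_killOutside_of_notMem hi hiV]

theorem IsWeightedHomogeneous.aeval_monomial {τ M : Type*} [AddCommMonoid M] {w : σ → M}
    {wτ : τ → M} {Θ : τ → MvPolynomial σ ℂ} (hΘ : ∀ t, IsWeightedHomogeneous w (Θ t) (wτ t))
    (a : τ →₀ ℕ) :
    IsWeightedHomogeneous w (aeval Θ (monomial a (1 : ℂ))) (Finsupp.weight wτ a) := by
  rw [MvPolynomial.aeval_monomial, map_one, one_mul, Finsupp.weight_apply]
  exact IsWeightedHomogeneous.prod _ _ _ fun t _ ↦ (hΘ t).pow _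

variable {τ : Type*}

/-- The difference of the two components of a bidegree. -/
def bidegreeDiff : ℕ × ℕ →+ ℤ :=
  (Nat.castAddMonoidHom ℤ).comp (AddMonoidHom.fst ℕ ℕ) -
    (Nat.castAddMonoidHom ℤ).comp (AddMonoidHom.snd ℕ ℕ)

theorem bidegreeDiff_apply (m : ℕ × ℕ) : bidegreeDiff m = m.1 - m.2 := rfl

/-- The span of the products of bidegree `m` of a monomial with exponent in `B` and a monomial in
the polynomials `Θ` restricted to the variables in `V`. -/
noncomputable def bidegreeSpan (w : σ → ℕ × ℕ) (wτ : τ → ℕ × ℕ) (Θ : τ → MvPolynomial σ ℂ)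
    (V : Set σ) (B : Finset (σ →₀ ℕ)) (m : ℕ × ℕ) : Submodule ℂ (MvPolynomial σ ℂ) :=
  Submodule.span ℂ {f | ∃ b ∈ B, ∃ a : τ →₀ ℕ, Finsupp.weight w b + Finsupp.weight wτ a = m ∧
    f = killOutside V (aeval Θ (monomial a (1 : ℂ))) * monomial b 1}

/-- The monomials with exponent in `B` form a basis of the span of all monomials in the variables
in `V` of bidegree difference `c` over the polynomial ring in the variables in `D`, acting through
`Θ` restricted to the variables in `V`. -/
structure IsMonomialBasis (w : σ → ℕ × ℕ) (wτ : τ → ℕ × ℕ) (Θ : τ → MvPolynomial σ ℂ)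
    (V : Set σ) (D : Set τ) (c : ℤ) (B : Finset (σ →₀ ℕ)) : Prop where
  support_subset : ∀ b ∈ B, ↑b.support ⊆ V
  bidegreeDiff_eq : ∀ b ∈ B, bidegreeDiff (Finsupp.weight w b) = c
  monomial_mem : ∀ μ : σ →₀ ℕ, ↑μ.support ⊆ V → bidegreeDiff (Finsupp.weight w μ) = c →
    monomial μ 1 ∈ bidegreeSpan w wτ Θ V B (Finsupp.weight w μ)
  killOutside_eq_zero : ∀ s : (σ →₀ ℕ) → MvPolynomial τ ℂ,
    ∑ b ∈ B, killOutside V (aeval Θ (s b)) * monomial b 1 = 0 → ∀ b ∈ B, killOutside D (s b) = 0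

variable {w : σ → ℕ × ℕ} {wτ : τ → ℕ × ℕ} {Θ : τ → MvPolynomial σ ℂ}

theorem killOutside_aeval_killOutside {V : Set σ} {D : Set τ}
    (h : ∀ t ∉ D, killOutside V (Θ t) = 0) (f : MvPolynomial τ ℂ) :
    killOutside V (aeval Θ (killOutside D f)) = killOutside V (aeval Θ f) := by
  suffices ((killOutside V).comp (aeval Θ)).comp (killOutside D) =
    (killOutside V).comp (aeval Θ) from DFunLike.congr_fun this f
  refine algHom_ext fun t ↦ ?_
  by_cases ht : t ∈ D
  · simp [killOutside_X_of_mem ht]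
  · simp [killOutside_X_of_notMem ht, h t ht]

open Classical in
theorem IsMonomialBasis.insert_indep {V : Set σ} {D : Set τ} {c c₁ : ℤ}
    {B₁ B₂ : Finset (σ →₀ ℕ)} {u v : σ} {t : τ} (huv : u ≠ v) (hu : u ∈ V) (ht : t ∉ D)
    (hΘt : killOutside V (Θ t) = X u * X v)
    (hΘ0 : ∀ t' ∉ insert t D, killOutside V (Θ t') = 0)
    (h₁ : IsMonomialBasis w wτ Θ (V \ {v}) D c₁ B₁) (h₂ : IsMonomialBasis w wτ Θ (V \ {u}) D c B₂)
    (s : (σ →₀ ℕ) → MvPolynomial τ ℂ)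
    (hs : ∑ b ∈ B₁.image (· + Finsupp.single u 1) ∪ B₂,
      killOutside V (aeval Θ (s b)) * monomial b 1 = 0) :
    ∀ b ∈ B₁.image (· + Finsupp.single u 1) ∪ B₂, killOutside (insert t D) (s b) = 0 := by
  have hdisj : Disjoint (B₁.image (· + Finsupp.single u 1)) B₂ := by
    rw [Finset.disjoint_left]
    intro b hb hb'
    obtain ⟨b', -, rfl⟩ := Finset.mem_image.1 hb
    exact (h₂.support_subset _ hb' (show u ∈ _ by simp)).2 rfl
  have hDt : insert t D \ {t} = D := Set.insert_sdiff_self_of_notMem ht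
  have hX : ∀ s : (σ →₀ ℕ) → MvPolynomial τ ℂ,
      ∑ b ∈ B₁.image (· + Finsupp.single u 1) ∪ B₂,
        killOutside V (aeval Θ (s b)) * monomial b 1 = 0 →
      ∀ b ∈ B₁.image (· + Finsupp.single u 1) ∪ B₂, X t ∣ killOutside (insert t D) (s b) := by
    intro s hs
    have hdvd : ∀ b, killOutside D (s b) = 0 → X t ∣ killOutside (insert t D) (s b) := by
      intro b hb
      have := X_dvd_killOutside_sub_killOutside (insert t D) t (s b)
      rwa [hDt, hb, sub_zero] at this
    rw [Finset.sum_union hdisj, Finset.sum_image (fun _ _ _ _ h ↦ add_right_cancel h)] at hs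
    have hs₂ : ∑ b ∈ B₂, killOutside (V \ {u}) (aeval Θ (s b)) * monomial b 1 = 0 := by
      have := congr_arg (killOutside (V \ {u})) hs
      rw [map_add, map_sum, map_sum, map_zero, Finset.sum_eq_zero, zero_add] at this
      · rw [← this]
        refine Finset.sum_congr rfl fun b hb ↦ ?_
        rw [map_mul, killOutside_killOutside Set.sdiff_subset,
          killOutside_monomial_of_subset (h₂.support_subset b hb)]
      · intro b _
        rw [map_mul, killOutside_monomial_of_notMem (i := u) (by simp) (by simp), mul_zero]
    have hB₂ : ∀ b ∈ B₂, X t ∣ killOutside (insert t D) (s b) := fun b hb ↦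
      hdvd b (h₂.killOutside_eq_zero s hs₂ b hb)
    have hs₁ : ∑ b ∈ B₁, killOutside (V \ {v}) (aeval Θ (s (b + Finsupp.single u 1))) *
        monomial b 1 = 0 := by
      have := congr_arg (killOutside (V \ {v})) hs
      rw [map_add, map_sum, map_sum, map_zero, add_comm, Finset.sum_eq_zero, zero_add] at this
      · refine (mul_eq_zero.1 ?_).resolve_left (X_ne_zero u)
        rw [Finset.mul_sum, ← this]
        refine Finset.sum_congr rfl fun b hb ↦ ?_
        rw [monomial_add_single, pow_one, map_mul, map_mul, killOutside_killOutside Set.sdiff_subset,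
          killOutside_monomial_of_subset (h₁.support_subset b hb), killOutside_X_of_mem (show u ∈ V \ {v} from ⟨hu, huv⟩)]
        ring
      · intro b hb
        obtain ⟨g, hg⟩ := hB₂ b hb
        rw [← killOutside_aeval_killOutside hΘ0, hg, map_mul, map_mul, map_mul, aeval_X, hΘt,
          map_mul, map_mul, killOutside_X_of_notMem (i := v) (by simp)]
        simp
    intro b hb
    obtain hb | hb := Finset.mem_union.1 hb
    · obtain ⟨b', hb', rfl⟩ := Finset.mem_image.1 hb
      exact hdvd _ (h₁.killOutside_eq_zero _ hs₁ b' hb')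
    · exact hB₂ b hb
  intro b hb
  refine eq_zero_of_forall_X_pow_dvd t fun N ↦ ?_
  induction N generalizing s b with
  | zero => simp
  | succ N ih =>
    choose! g hg using hX s hs
    have hg' : ∑ b ∈ B₁.image (· + Finsupp.single u 1) ∪ B₂,
        killOutside V (aeval Θ (g b)) * monomial b 1 = 0 := by
      refine (mul_eq_zero.1 ?_).resolve_left (mul_ne_zero (X_ne_zero (R := ℂ) u) (X_ne_zero v))
      rw [Finset.mul_sum, ← hs]
      refine Finset.sum_congr rfl fun b hb ↦ ?_
      rw [← killOutside_aeval_killOutside hΘ0 (s b), hg b hb, map_mul, map_mul, aeval_X, hΘt]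
      ring
    rw [← killOutside_killOutside subset_rfl, hg b hb, map_mul,
      killOutside_X_of_mem (Set.mem_insert t D), pow_succ']
    exact mul_dvd_mul_left _ (ih g hg' b hb)

theorem mem_of_forall_monomial_mem {M : Type*} [AddCommMonoid M] {w : σ → M} {m : M} {V S : Set σ}
    {f : MvPolynomial σ ℂ} (hf : IsWeightedHomogeneous w f m) (hV : killOutside V f = f)
    (hS : ∀ i ∈ S, X i ∣ f) (W : Submodule ℂ (MvPolynomial σ ℂ))
    (h : ∀ ν : σ →₀ ℕ, ↑ν.support ⊆ V → S ⊆ ↑ν.support → Finsupp.weight w ν = m →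
      monomial ν 1 ∈ W) : f ∈ W := by
  classical
  rw [f.as_sum]
  refine W.sum_mem fun ν hν ↦ ?_
  rw [mem_support_iff] at hν
  rw [← mul_one (coeff ν f), ← smul_eq_mul, ← smul_monomial]
  refine W.smul_mem _ (h ν ?_ ?_ (hf hν))
  · by_contra hs
    obtain ⟨i, hi, hiV⟩ := Set.not_subset.1 hs
    rw [← hV, coeff_killOutside_of_notMem hi hiV] at hν
    exact hν rfl
  · intro i hi
    obtain ⟨g, rfl⟩ := hS i hi
    by_contra hiν
    rw [Finset.mem_coe] at hiν
    rw [coeff_X_mul', if_neg hiν] at hν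
    exact hν rfl

theorem mem_bidegreeSpan {V : Set σ} {B : Finset (σ →₀ ℕ)} {m : ℕ × ℕ} {b : σ →₀ ℕ} (hb : b ∈ B)
    (a : τ →₀ ℕ) (h : Finsupp.weight w b + Finsupp.weight wτ a = m) :
    killOutside V (aeval Θ (monomial a (1 : ℂ))) * monomial b 1 ∈ bidegreeSpan w wτ Θ V B m :=
  Submodule.subset_span ⟨b, hb, a, h, rfl⟩

theorem mul_mem_of_mem_bidegreeSpan {V : Set σ} {B : Finset (σ →₀ ℕ)} {m : ℕ × ℕ}
    {W : Submodule ℂ (MvPolynomial σ ℂ)} (p : MvPolynomial σ ℂ)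
    (h : ∀ b ∈ B, ∀ a : τ →₀ ℕ, Finsupp.weight w b + Finsupp.weight wτ a = m →
      p * (killOutside V (aeval Θ (monomial a (1 : ℂ))) * monomial b 1) ∈ W)
    {f : MvPolynomial σ ℂ} (hf : f ∈ bidegreeSpan w wτ Θ V B m) : p * f ∈ W := by
  induction hf using Submodule.span_induction with
  | mem f hf =>
    obtain ⟨b, hb, a, hab, rfl⟩ := hf
    exact h b hb a hab
  | zero => simp
  | add f g _ _ hf hg => exact mul_add p f g ▸ W.add_mem hf hg
  | smul r f _ hf => exact mul_smul_comm r p f ▸ W.smul_mem r hf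

theorem killOutside_mul_mem_bidegreeSpan {V : Set σ} {B : Finset (σ →₀ ℕ)} {m : ℕ × ℕ} {t : τ}
    {f : MvPolynomial σ ℂ} (hf : f ∈ bidegreeSpan w wτ Θ V B m) :
    killOutside V (Θ t) * f ∈ bidegreeSpan w wτ Θ V B (m + wτ t) := by
  refine mul_mem_of_mem_bidegreeSpan _ (fun b hb a hba ↦ ?_) hf
  subst hba
  have := mem_bidegreeSpan (w := w) (wτ := wτ) (Θ := Θ) (V := V) hb (a + Finsupp.single t 1) rfl
  rw [monomial_add_single, pow_one, map_mul, map_mul, aeval_X, map_add,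
    Finsupp.weight_single, one_smul, ← add_assoc] at this
  convert this using 1
  ring

open Classical in
theorem IsMonomialBasis.insert_span (hΘ : ∀ t, IsWeightedHomogeneous w (Θ t) (wτ t))
    {V : Set σ} {D : Set τ} {c c₁ : ℤ}
    {B₁ B₂ : Finset (σ →₀ ℕ)} {u v : σ} {t : τ} (huv : u ≠ v) (hu : u ∈ V)
    (hΘt : killOutside V (Θ t) = X u * X v) (hw : w u + w v = wτ t) (hwt : wτ t = (1, 1))
    (hc : bidegreeDiff (w u) + c₁ = c)
    (h₁ : IsMonomialBasis w wτ Θ (V \ {v}) D c₁ B₁) (h₂ : IsMonomialBasis w wτ Θ (V \ {u}) D c B₂)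
    (μ : σ →₀ ℕ) (hμ : ↑μ.support ⊆ V) (hμc : bidegreeDiff (Finsupp.weight w μ) = c) :
    monomial μ 1 ∈ bidegreeSpan w wτ Θ V (B₁.image (· + Finsupp.single u 1) ∪ B₂)
      (Finsupp.weight w μ) := by
  have hdecomp : ∀ {μ : σ →₀ ℕ} {i : σ}, i ∈ μ.support → ∃ ν, μ = ν + Finsupp.single i 1 :=
    fun {μ i} hi ↦ ⟨μ - Finsupp.single i 1, (tsub_add_cancel_of_le
      (Finsupp.single_le_iff.2 (Nat.one_le_iff_ne_zero.2 (Finsupp.mem_support_iff.1 hi)))).symm⟩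
  have hhom : ∀ U U' a b, IsWeightedHomogeneous w
      ((killOutside U (aeval Θ (monomial a (1 : ℂ))) -
        killOutside U' (aeval Θ (monomial a (1 : ℂ)))) * monomial b (1 : ℂ))
      (Finsupp.weight w b + Finsupp.weight wτ a) := fun U U' a b ↦ by
    rw [add_comm]
    exact (Submodule.sub_mem (weightedHomogeneousSubmodule ℂ w _)
      ((IsWeightedHomogeneous.aeval_monomial hΘ a).killOutside U)
      ((IsWeightedHomogeneous.aeval_monomial hΘ a).killOutside U')).mul
      (isWeightedHomogeneous_monomial _ _ _ rfl)
  induction hn : (Finsupp.weight w μ).1 using Nat.strong_induction_on generalizing μ with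
  | _ n ih =>
  have huv_mem : ∀ ν : σ →₀ ℕ, ↑ν.support ⊆ V → ({u, v} : Set σ) ⊆ ν.support →
      Finsupp.weight w ν = Finsupp.weight w μ →
      monomial ν 1 ∈ bidegreeSpan w wτ Θ V (B₁.image (· + Finsupp.single u 1) ∪ B₂)
        (Finsupp.weight w μ) := by
    intro ν hν hS hm
    obtain ⟨ν, rfl⟩ := hdecomp (hS (Set.mem_insert u _))
    have hv : v ∈ ν.support := by
      have := hS (Set.mem_insert_of_mem u rfl)
      simpa [huv.symm, huv] using this
    obtain ⟨ν, rfl⟩ := hdecomp hv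
    have hm' : Finsupp.weight w ν + wτ t = Finsupp.weight w μ := by
      rw [← hm, ← hw]
      simp only [map_add, Finsupp.weight_single, one_smul]
      abel
    have := ih (Finsupp.weight w ν).1 ?_ ν ?_ ?_ rfl
    · have := killOutside_mul_mem_bidegreeSpan (t := t) this
      rw [hm', hΘt] at this
      rw [monomial_add_single, monomial_add_single, pow_one, pow_one]
      convert this using 1
      ring
    · rw [← hn, ← hm', hwt]
      simp
    · refine subset_trans ?_ hν
      intro i
      simp only [Finset.mem_coe, Finsupp.mem_support_iff, Finsupp.add_apply]
      omega
    · rw [← hμc, ← hm', hwt, map_add]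
      simp [bidegreeDiff_apply]
  have hu_mem : ∀ ν : σ →₀ ℕ, ↑ν.support ⊆ V → ({u} : Set σ) ⊆ ν.support →
      Finsupp.weight w ν = Finsupp.weight w μ →
      monomial ν 1 ∈ bidegreeSpan w wτ Θ V (B₁.image (· + Finsupp.single u 1) ∪ B₂)
        (Finsupp.weight w μ) := by
    intro ν hν hS hm
    by_cases hv : v ∈ ν.support
    · exact huv_mem ν hν (Set.insert_subset (hS rfl) (by simpa using hv)) hm
    obtain ⟨ν, rfl⟩ := hdecomp (hS rfl)
    rw [map_add, Finsupp.weight_single, one_smul] at hm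
    have hmem := h₁.monomial_mem ν (fun i hi ↦ ⟨hν ?_, ?_⟩) ?_
    · rw [monomial_add_single, pow_one, mul_comm]
      refine mul_mem_of_mem_bidegreeSpan _ (fun b hb a hba ↦ ?_) hmem
      have hba' : Finsupp.weight w (b + Finsupp.single u 1) + Finsupp.weight wτ a =
          Finsupp.weight w μ := by
        rw [← hm, ← hba, map_add, Finsupp.weight_single, one_smul]
        abel
      have hmem₁ := mem_bidegreeSpan (w := w) (wτ := wτ) (Θ := Θ) (V := V) (Finset.mem_union_left B₂
        (Finset.mem_image_of_mem (· + Finsupp.single u 1) hb)) a hba'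
      have hmem₂ := mem_of_forall_monomial_mem (hba' ▸ hhom V (V \ {v}) a (b + Finsupp.single u 1))
        (V := V) (S := {u, v}) ?_ ?_ _ huv_mem
      · convert Submodule.sub_mem _ hmem₁ hmem₂ using 1
        rw [monomial_add_single, pow_one]
        ring
      · rw [map_mul, map_sub, killOutside_killOutside_of_superset subset_rfl,
          killOutside_killOutside_of_superset Set.sdiff_subset, monomial_add_single, pow_one,
          map_mul, killOutside_X_of_mem hu, killOutside_monomial_of_subset]
        exact (h₁.support_subset b hb).trans Set.sdiff_subset
      · rintro i (rfl | rfl)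
        · rw [monomial_add_single, pow_one]
          exact ((dvd_refl _).mul_left _).mul_left _
        · exact (X_dvd_killOutside_sub_killOutside V _ _).mul_right _
    · simp only [Finset.mem_coe, Finsupp.mem_support_iff, Finsupp.add_apply] at hi ⊢
      omega
    · rintro rfl
      simp only [Finset.mem_coe, Finsupp.mem_support_iff, Finsupp.add_apply] at hi hv
      omega
    · rw [← hc, ← hm, map_add] at hμc
      linarith
  by_cases huμ : u ∈ μ.support
  · exact hu_mem μ hμ (by simpa using huμ) rfl
  have hmem := h₂.monomial_mem μ (fun i hi ↦ ⟨hμ hi, fun h ↦ huμ (h ▸ hi)⟩) hμc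
  rw [← one_mul (monomial μ _)]
  refine mul_mem_of_mem_bidegreeSpan _ (fun b hb a hba ↦ ?_) hmem
  have hmem₁ := mem_bidegreeSpan (w := w) (wτ := wτ) (Θ := Θ) (V := V) (Finset.mem_union_right
    (B₁.image (· + Finsupp.single u 1)) hb) a hba
  have hmem₂ := mem_of_forall_monomial_mem (hba ▸ hhom V (V \ {u}) a b)
    (V := V) (S := {u}) ?_ ?_ _ hu_mem
  · convert Submodule.sub_mem _ hmem₁ hmem₂ using 1
    ring
  · rw [map_mul, map_sub, killOutside_killOutside_of_superset subset_rfl,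
      killOutside_killOutside_of_superset Set.sdiff_subset, killOutside_monomial_of_subset]
    exact (h₂.support_subset b hb).trans Set.sdiff_subset
  · rintro i rfl
    exact (X_dvd_killOutside_sub_killOutside V _ _).mul_right _

open Classical in
theorem IsMonomialBasis.insert (hΘ : ∀ t, IsWeightedHomogeneous w (Θ t) (wτ t))
    {V : Set σ} {D : Set τ} {c c₁ : ℤ}
    {B₁ B₂ : Finset (σ →₀ ℕ)} {u v : σ} {t : τ} (huv : u ≠ v) (hu : u ∈ V) (ht : t ∉ D)
    (hΘt : killOutside V (Θ t) = X u * X v)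
    (hΘ0 : ∀ t' ∉ insert t D, killOutside V (Θ t') = 0)
    (hw : w u + w v = wτ t) (hwt : wτ t = (1, 1)) (hc : bidegreeDiff (w u) + c₁ = c)
    (h₁ : IsMonomialBasis w wτ Θ (V \ {v}) D c₁ B₁)
    (h₂ : IsMonomialBasis w wτ Θ (V \ {u}) D c B₂) :
    IsMonomialBasis w wτ Θ V (insert t D) c (B₁.image (· + Finsupp.single u 1) ∪ B₂) where
  support_subset b hb := by
    obtain hb | hb := Finset.mem_union.1 hb
    · obtain ⟨b, hb', rfl⟩ := Finset.mem_image.1 hb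
      intro i hi
      obtain rfl | hiu := eq_or_ne i u
      · exact hu
      · refine (h₁.support_subset b hb' (?_ : i ∈ b.support)).1
        simpa [Finsupp.single_apply, hiu.symm] using hi
    · exact (h₂.support_subset b hb).trans Set.sdiff_subset
  bidegreeDiff_eq b hb := by
    obtain hb | hb := Finset.mem_union.1 hb
    · obtain ⟨b, hb', rfl⟩ := Finset.mem_image.1 hb
      rw [map_add, map_add, h₁.bidegreeDiff_eq b hb', Finsupp.weight_single, one_smul, add_comm, hc]
    · exact h₂.bidegreeDiff_eq b hb
  monomial_mem := h₁.insert_span hΘ huv hu hΘt hw hwt hc h₂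
  killOutside_eq_zero := h₁.insert_indep huv hu ht hΘt hΘ0 h₂

section hsop

variable {r : σ → ℕ} {N : ℕ}

/-- The variables of weight zero together with the `N` first antidiagonal sums of the products of
a variable of weight `(1, 0)` and a variable of weight `(0, 1)`, with respect to the enumeration
`r` of the variables. -/
noncomputable def antidiagonalSums [Fintype σ] [DecidableEq σ] (w : σ → ℕ × ℕ) (r : σ → ℕ)
    (N : ℕ) : {z : σ // w z = 0} ⊕ Fin N → MvPolynomial σ ℂ :=
  Sum.elim (fun z ↦ X z) fun k ↦
    ∑ x : σ × σ with w x.1 = (1, 0) ∧ w x.2 = (0, 1) ∧ r x.1 + r x.2 = k, X x.1 * X x.2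

/-- The bidegrees of the polynomials in `antidiagonalSums`. -/
def antidiagonalBidegree (w : σ → ℕ × ℕ) (N : ℕ) : {z : σ // w z = 0} ⊕ Fin N → ℕ × ℕ :=
  Sum.elim (fun _ ↦ 0) fun _ ↦ (1, 1)

theorem isWeightedHomogeneous_antidiagonalSums [Fintype σ] [DecidableEq σ]
    (t : {z : σ // w z = 0} ⊕ Fin N) :
    IsWeightedHomogeneous w (antidiagonalSums w r N t) (antidiagonalBidegree w N t) := by
  obtain z | k := t
  · simpa [antidiagonalSums, antidiagonalBidegree, z.2] using isWeightedHomogeneous_X ℂ w z.1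
  · refine Submodule.sum_mem (weightedHomogeneousSubmodule ℂ w _) fun x hx ↦ ?_
    obtain ⟨-, h₁, h₂, -⟩ := Finset.mem_filter.1 hx
    have := (isWeightedHomogeneous_X ℂ w x.1).mul (isWeightedHomogeneous_X ℂ w x.2)
    rwa [h₁, h₂] at this

/-- The variables of weight zero, the `p` first variables of weight `(1, 0)` and the `q` first
variables of weight `(0, 1)`. -/
def initialVars (w : σ → ℕ × ℕ) (r : σ → ℕ) (p q : ℕ) : Set σ :=
  {i | (w i = (1, 0) → r i < p) ∧ (w i = (0, 1) → r i < q)}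

/-- The indices of all variables of weight zero and of the `m` first antidiagonals. -/
def initialIndices (w : σ → ℕ × ℕ) (N m : ℕ) : Set ({z : σ // w z = 0} ⊕ Fin N) :=
  {t | ∀ k, t = Sum.inr k → k < m}

theorem initialVars_diff_pos (hr : ∀ i j, w i = w j → w i ≠ 0 → r i = r j → i = j) {p q : ℕ} {u : σ}
    (hu : w u = (1, 0)) (hru : r u = p) :
    initialVars w r (p + 1) q \ {u} = initialVars w r p q := by
  ext i
  simp only [initialVars, Set.mem_sdiff, Set.mem_ofPred_eq, Set.mem_singleton_iff]
  constructor
  · rintro ⟨⟨h₁, h₂⟩, h⟩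
    refine ⟨fun hi ↦ lt_of_le_of_ne (Nat.le_of_lt_succ (h₁ hi)) fun hp ↦ h ?_, h₂⟩
    exact hr i u (hi.trans hu.symm) (by simp [hi]) (hp.trans hru.symm)
  · rintro ⟨h₁, h₂⟩
    refine ⟨⟨fun hi ↦ (h₁ hi).trans (Nat.lt_succ_self p), h₂⟩, ?_⟩
    rintro rfl
    exact (h₁ hu).ne hru

theorem initialVars_diff_neg (hr : ∀ i j, w i = w j → w i ≠ 0 → r i = r j → i = j) {p q : ℕ} {v : σ}
    (hv : w v = (0, 1)) (hrv : r v = q) :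
    initialVars w r p (q + 1) \ {v} = initialVars w r p q := by
  ext i
  simp only [initialVars, Set.mem_sdiff, Set.mem_ofPred_eq, Set.mem_singleton_iff]
  constructor
  · rintro ⟨⟨h₁, h₂⟩, h⟩
    refine ⟨h₁, fun hi ↦ lt_of_le_of_ne (Nat.le_of_lt_succ (h₂ hi)) fun hp ↦ h ?_⟩
    exact hr i v (hi.trans hv.symm) (by simp [hi]) (hp.trans hrv.symm)
  · rintro ⟨h₁, h₂⟩
    refine ⟨⟨h₁, fun hi ↦ (h₂ hi).trans (Nat.lt_succ_self q)⟩, ?_⟩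
    rintro rfl
    exact (h₂ hv).ne hrv

theorem insert_initialIndices (m : Fin N) :
    insert (Sum.inr m) (initialIndices w N m) = initialIndices w N (m + 1) := by
  ext t
  obtain z | k := t
  · simp [initialIndices]
  · simp only [initialIndices, Set.mem_insert_iff, Set.mem_ofPred_eq, Sum.inr.injEq,
      forall_eq', ← Fin.ext_iff, Nat.lt_succ_iff_lt_or_eq]
    rw [or_comm, Fin.ext_iff]

theorem weight_fst_eq_zero {q : ℕ} (hw : ∀ i, w i = 0 ∨ w i = (1, 0) ∨ w i = (0, 1)) {μ : σ →₀ ℕ}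
    (hμ : ↑μ.support ⊆ initialVars w r 0 q) : (Finsupp.weight w μ).1 = 0 := by
  rw [Finsupp.weight_apply, Finsupp.sum, Prod.fst_sum]
  refine Finset.sum_eq_zero fun i hi ↦ ?_
  obtain h | h | h := hw i
  · simp [h]
  · exact absurd ((hμ hi).1 h) (Nat.not_lt_zero _)
  · simp [h]

theorem weight_snd_eq_zero {p : ℕ} (hw : ∀ i, w i = 0 ∨ w i = (1, 0) ∨ w i = (0, 1)) {μ : σ →₀ ℕ}
    (hμ : ↑μ.support ⊆ initialVars w r p 0) : (Finsupp.weight w μ).2 = 0 := by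
  rw [Finsupp.weight_apply, Finsupp.sum, Prod.snd_sum]
  refine Finset.sum_eq_zero fun i hi ↦ ?_
  obtain h | h | h := hw i
  · simp [h]
  · simp [h]
  · exact absurd ((hμ hi).2 h) (Nat.not_lt_zero _)

theorem isMonomialBasis_empty {τ : Type*} {wτ : τ → ℕ × ℕ} {Θ : τ → MvPolynomial σ ℂ}
    {V : Set σ} {D : Set τ} {c : ℤ}
    (h : ∀ μ : σ →₀ ℕ, ↑μ.support ⊆ V → bidegreeDiff (Finsupp.weight w μ) ≠ c) :
    IsMonomialBasis w wτ Θ V D c ∅ where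
  support_subset b hb := by simp at hb
  bidegreeDiff_eq b hb := by simp at hb
  monomial_mem μ hμ hc := absurd hc (h μ hμ)
  killOutside_eq_zero _ _ b hb := by simp at hb

theorem isMonomialBasis_empty_of_pos {τ : Type*} {wτ : τ → ℕ × ℕ} {Θ : τ → MvPolynomial σ ℂ}
    {D : Set τ} {c : ℤ} {q : ℕ} (hw : ∀ i, w i = 0 ∨ w i = (1, 0) ∨ w i = (0, 1)) (hc : 0 < c) :
    IsMonomialBasis w wτ Θ (initialVars w r 0 q) D c ∅ := by
  refine isMonomialBasis_empty fun μ hμ h ↦ ?_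
  rw [bidegreeDiff_apply, weight_fst_eq_zero hw hμ] at h
  omega

theorem isMonomialBasis_empty_of_neg {τ : Type*} {wτ : τ → ℕ × ℕ} {Θ : τ → MvPolynomial σ ℂ}
    {D : Set τ} {c : ℤ} {p : ℕ} (hw : ∀ i, w i = 0 ∨ w i = (1, 0) ∨ w i = (0, 1)) (hc : c < 0) :
    IsMonomialBasis w wτ Θ (initialVars w r p 0) D c ∅ := by
  refine isMonomialBasis_empty fun μ hμ h ↦ ?_
  rw [bidegreeDiff_apply, weight_snd_eq_zero hw hμ] at h
  omega

variable [Fintype σ] [DecidableEq σ]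

theorem killOutside_antidiagonalSums {p q : ℕ} {u v : σ} {k : Fin N}
    (hr : ∀ i j, w i = w j → w i ≠ 0 → r i = r j → i = j)
    (hu : w u = (1, 0)) (hv : w v = (0, 1)) (hru : r u = p) (hrv : r v = q) (hk : p + q = k) :
    killOutside (initialVars w r (p + 1) (q + 1)) (antidiagonalSums w r N (Sum.inr k)) =
      X u * X v := by
  rw [antidiagonalSums, Sum.elim_inr, map_sum, Finset.sum_eq_single (u, v)]
  · rw [map_mul, killOutside_X_of_mem, killOutside_X_of_mem] <;> simp [initialVars, *]
  · rintro ⟨x, y⟩ hxy hne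
    obtain ⟨-, hx, hy, hk'⟩ := Finset.mem_filter.1 hxy
    dsimp only at hx hy hk' ⊢
    rw [map_mul]
    by_cases hxV : x ∈ initialVars w r (p + 1) (q + 1)
    · rw [killOutside_X_of_notMem (i := y), mul_zero]
      intro hyV
      have h₁ := hxV.1 hx
      have h₂ := hyV.2 hy
      refine hne (Prod.ext (hr x u (hx.trans hu.symm) (by simp [hx]) ?_)
        (hr y v (hy.trans hv.symm) (by simp [hy]) ?_)) <;> omega
    · rw [killOutside_X_of_notMem hxV, zero_mul]
  · intro h
    simp [*] at h

theorem killOutside_antidiagonalSums_eq_zero {p q : ℕ} {k : Fin N} (hk : p + q ≤ k + 1) :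
    killOutside (initialVars w r p q) (antidiagonalSums w r N (Sum.inr k)) = 0 := by
  rw [antidiagonalSums, Sum.elim_inr, map_sum]
  refine Finset.sum_eq_zero fun x hx ↦ ?_
  obtain ⟨-, hx₁, hx₂, hk'⟩ := Finset.mem_filter.1 hx
  rw [map_mul]
  by_cases hxV : x.1 ∈ initialVars w r p q
  · rw [killOutside_X_of_notMem (i := x.2), mul_zero]
    intro hyV
    have h₁ := hxV.1 hx₁
    have h₂ := hyV.2 hx₂
    omega
  · rw [killOutside_X_of_notMem hxV, zero_mul]

theorem exists_aeval_antidiagonalSums_eq {μ : σ →₀ ℕ} (hμ : ∀ i ∈ μ.support, w i = 0) :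
    ∃ ν, Finsupp.weight (antidiagonalBidegree w N) ν = 0 ∧
      aeval (antidiagonalSums w r N) (monomial ν (1 : ℂ)) = monomial μ 1 := by
  induction μ using Finsupp.induction with
  | zero => exact ⟨0, map_zero _, by rw [monomial_zero', monomial_zero', map_one, map_one, map_one]⟩
  | single_add i k μ hi hk ih =>
    rw [Finsupp.support_single_add hi hk] at hμ
    obtain ⟨ν, hν, hμν⟩ := ih fun j hj ↦ hμ j (Finset.mem_cons_of_mem hj)
    refine ⟨Finsupp.single (Sum.inl ⟨i, hμ i (Finset.mem_cons_self _ _)⟩) k + ν, ?_, ?_⟩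
    · rw [map_add, hν, Finsupp.weight_single]
      simp [antidiagonalBidegree]
    · rw [add_comm, monomial_add_single, map_mul, hμν, map_pow, aeval_X, add_comm (Finsupp.single _ _),
        monomial_add_single]
      rfl

theorem isMonomialBasis_singleton (hw : ∀ i, w i = 0 ∨ w i = (1, 0) ∨ w i = (0, 1)) :
    IsMonomialBasis w (antidiagonalBidegree w N) (antidiagonalSums w r N) (initialVars w r 0 1)
      (initialIndices w N 0) 0 {0} where
  support_subset b hb := by
    rw [Finset.mem_singleton.1 hb]
    simp
  bidegreeDiff_eq b hb := by
    rw [Finset.mem_singleton.1 hb, map_zero, map_zero]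
  monomial_mem μ hμ hc := by
    have h₁ := weight_fst_eq_zero hw hμ
    have h₂ : (Finsupp.weight w μ).2 = 0 := by
      rw [bidegreeDiff_apply, h₁] at hc
      omega
    have hμ0 : ∀ i ∈ μ.support, w i = 0 := by
      intro i hi
      have := Finsupp.le_weight_of_ne_zero' (w := w)  (f := μ) (s := i) (by simpa using hi)
      rw [Prod.le_def] at this
      exact Prod.ext (by simpa [h₁] using this.1) (by simpa [h₂] using this.2)
    obtain ⟨ν, hν, hμν⟩ := exists_aeval_antidiagonalSums_eq (r := r) (N := N) hμ0
    have := mem_bidegreeSpan (w := w) (wτ := antidiagonalBidegree w N)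
      (Θ := antidiagonalSums w r N) (V := initialVars w r 0 1) (Finset.mem_singleton_self 0) ν rfl
    rw [hμν, hν, killOutside_monomial_of_subset hμ, monomial_mul, mul_one, add_zero, add_zero,
      map_zero] at this
    rwa [show Finsupp.weight w μ = 0 from Prod.ext h₁ h₂]
  killOutside_eq_zero s hs b hb := by
    rw [Finset.mem_singleton.1 hb]
    rw [Finset.sum_singleton, ← C_apply, map_one, mul_one] at hs
    set ψ : MvPolynomial σ ℂ →ₐ[ℂ] MvPolynomial ({z : σ // w z = 0} ⊕ Fin N) ℂ :=
      aeval fun i ↦ if h : w i = 0 then X (Sum.inl ⟨i, h⟩) else 0 with hψ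
    suffices (ψ.comp (killOutside (initialVars w r 0 1))).comp (aeval (antidiagonalSums w r N)) =
        killOutside (initialIndices w N 0) by
      rw [← this, AlgHom.comp_apply, AlgHom.comp_apply, hs, map_zero]
    refine algHom_ext fun t ↦ ?_
    obtain z | k := t
    · rw [killOutside_X_of_mem (by simp [initialIndices]), AlgHom.comp_apply, AlgHom.comp_apply,
        aeval_X, antidiagonalSums, Sum.elim_inl, killOutside_X_of_mem (by simp [initialVars, z.2, Prod.ext_iff]),
        hψ, aeval_X, dif_pos z.2]
    · rw [killOutside_X_of_notMem (by simp [initialIndices]), AlgHom.comp_apply, AlgHom.comp_apply,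
        aeval_X, killOutside_antidiagonalSums_eq_zero (by simp), map_zero]

theorem exists_isMonomialBasis {p q : ℕ} (hw : ∀ i, w i = 0 ∨ w i = (1, 0) ∨ w i = (0, 1))
    (hr : ∀ i j, w i = w j → w i ≠ 0 → r i = r j → i = j)
    (hp : ∀ k < p, ∃ u, w u = (1, 0) ∧ r u = k) (hq : ∀ k < q, ∃ v, w v = (0, 1) ∧ r v = k)
    (hN : p + q ≤ N + 1) {c : ℤ} (hc₁ : -(p : ℤ) < c) (hc₂ : c < q) :
    ∃ B, IsMonomialBasis w (antidiagonalBidegree w N) (antidiagonalSums w r N)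
      (initialVars w r p q) (initialIndices w N (p + q - 1)) c B := by
  induction h : p + q generalizing p q c with
  | zero => omega
  | succ n ih =>
  obtain _ | p := p
  · exact ⟨∅, isMonomialBasis_empty_of_pos hw (by simpa using hc₁)⟩
  obtain _ | q := q
  · exact ⟨∅, isMonomialBasis_empty_of_neg hw (by simpa using hc₂)⟩
  obtain ⟨u, hu, hru⟩ := hp p (Nat.lt_succ_self p)
  obtain ⟨v, hv, hrv⟩ := hq q (Nat.lt_succ_self q)
  have huv : u ≠ v := by
    rintro rfl
    simp [hu] at hv
  have hD : initialIndices w N (n + 1 - 1) =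
      insert (Sum.inr ⟨p + q, by omega⟩) (initialIndices w N (p + q)) := by
    rw [insert_initialIndices ⟨p + q, by omega⟩]
    congr 1
    dsimp only
    omega
  have ht : Sum.inr ⟨p + q, by omega⟩ ∉ initialIndices w N (p + q) := by simp [initialIndices]
  have hΘt := killOutside_antidiagonalSums (k := (⟨p + q, by omega⟩ : Fin N)) hr hu hv hru hrv rfl
  have hΘ0 : ∀ t' ∉ insert (Sum.inr ⟨p + q, by omega⟩) (initialIndices w N (p + q)),
      killOutside (initialVars w r (p + 1) (q + 1)) (antidiagonalSums w r N t') = 0 := by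
    intro t' ht'
    rw [insert_initialIndices ⟨p + q, by omega⟩] at ht'
    obtain z | k := t'
    · simp [initialIndices] at ht'
    · refine killOutside_antidiagonalSums_eq_zero ?_
      simp [initialIndices] at ht'
      omega
  have hpos : initialVars w r (p + 1) (q + 1) \ {u} = initialVars w r p (q + 1) :=
    initialVars_diff_pos hr hu hru
  have hneg : initialVars w r (p + 1) (q + 1) \ {v} = initialVars w r (p + 1) q :=
    initialVars_diff_neg hr hv hrv
  have huV : u ∈ initialVars w r (p + 1) (q + 1) := by simp [initialVars, hu, hru]
  have hvV : v ∈ initialVars w r (p + 1) (q + 1) := by simp [initialVars, hv, hrv]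
  have hw₁ : w u + w v = antidiagonalBidegree w N (Sum.inr ⟨p + q, by omega⟩) := by
    simp [hu, hv, antidiagonalBidegree]
  have ihp := fun c hc₁ hc₂ ↦ ih (p := p) (q := q + 1) (c := c) (fun k hk ↦ hp k (by omega)) hq
    (by omega) hc₁ hc₂ (by omega)
  have ihq := fun c hc₁ hc₂ ↦ ih (p := p + 1) (q := q) (c := c) hp (fun k hk ↦ hq k (by omega))
    (by omega) hc₁ hc₂ (by omega)
  rw [show n - 1 = p + q by omega] at ihp ihq
  rw [hD]
  by_cases h₁ : -(p : ℤ) < c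
  · obtain ⟨B₁, hB₁⟩ := ihq (c - 1) (by push_cast at *; omega) (by push_cast at *; omega)
    obtain ⟨B₂, hB₂⟩ := ihp c h₁ hc₂
    exact ⟨_, IsMonomialBasis.insert isWeightedHomogeneous_antidiagonalSums huv huV ht hΘt hΘ0 hw₁
      rfl (by simp [hu, bidegreeDiff_apply]) (hneg ▸ hB₁) (hpos ▸ hB₂)⟩
  by_cases h₂ : c < q
  · obtain ⟨B₁, hB₁⟩ := ihp (c + 1) (by push_cast at *; omega) (by push_cast at *; omega)
    obtain ⟨B₂, hB₂⟩ := ihq c hc₁ h₂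
    exact ⟨_, IsMonomialBasis.insert isWeightedHomogeneous_antidiagonalSums huv.symm hvV ht
      (hΘt.trans (mul_comm _ _)) hΘ0 ((add_comm _ _).trans hw₁)
      rfl (by simp [hv, bidegreeDiff_apply]) (hpos ▸ hB₁) (hneg ▸ hB₂)⟩
  · obtain ⟨rfl, rfl, rfl⟩ : p = 0 ∧ q = 0 ∧ c = 0 := by omega
    exact ⟨_, IsMonomialBasis.insert isWeightedHomogeneous_antidiagonalSums huv huV ht hΘt hΘ0 hw₁
      rfl (by simp [hu, bidegreeDiff_apply])
      (hneg ▸ isMonomialBasis_empty_of_neg (c := -1) hw (by simp))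
      (hpos ▸ isMonomialBasis_singleton hw)⟩

end hsop

section expand

variable [Fintype σ]

/-- The exponent obtained from `μ` by multiplying the entry at `i` by `e i` for all `i`. -/
noncomputable def scaleExponent (e : σ → ℕ) (μ : σ →₀ ℕ) : σ →₀ ℕ :=
  Finsupp.equivFunOnFinite.symm fun i ↦ e i * μ i

/-- The substitution of `X i ^ e i` for `X i`. -/
noncomputable def expandVars (e : σ → ℕ) : MvPolynomial σ ℂ →ₐ[ℂ] MvPolynomial σ ℂ :=
  aeval fun i ↦ X i ^ e i

theorem scaleExponent_apply (e : σ → ℕ) (μ : σ →₀ ℕ) (i : σ) :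
    scaleExponent e μ i = e i * μ i := rfl

theorem expandVars_monomial (e : σ → ℕ) (μ : σ →₀ ℕ) (c : ℂ) :
    expandVars e (monomial μ c) = monomial (scaleExponent e μ) c := by
  rw [expandVars, aeval_monomial, monomial_eq, Finsupp.prod_fintype _ _ (by simp),
    Finsupp.prod_fintype _ _ (by simp), algebraMap_eq]
  simp_rw [scaleExponent_apply, pow_mul]

theorem scaleExponent_add_eq_iff {e : σ → ℕ} {α β μ ν : σ →₀ ℕ} (hα : ∀ i, α i < e i)
    (hβ : ∀ i, β i < e i) :
    scaleExponent e μ + α = scaleExponent e ν + β ↔ μ = ν ∧ α = β := by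
  refine ⟨fun h ↦ ?_, fun h ↦ by rw [h.1, h.2]⟩
  have key : ∀ i, μ i = ν i ∧ α i = β i := by
    intro i
    have hi := DFunLike.congr_fun h i
    rw [Finsupp.add_apply, Finsupp.add_apply, scaleExponent_apply, scaleExponent_apply] at hi
    have he : 0 < e i := (Nat.zero_le _).trans_lt (hα i)
    constructor
    · have := congr_arg (· / e i) hi
      simpa [Nat.mul_add_div he, Nat.div_eq_of_lt (hα i), Nat.div_eq_of_lt (hβ i)] using this
    · have := congr_arg (· % e i) hi
      simpa [Nat.mul_add_mod, Nat.mod_eq_of_lt (hα i), Nat.mod_eq_of_lt (hβ i)] using this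
  exact ⟨Finsupp.ext fun i ↦ (key i).1, Finsupp.ext fun i ↦ (key i).2⟩

theorem coeff_expandVars_mul_monomial [DecidableEq σ] {e : σ → ℕ} {α β : σ →₀ ℕ}
    (hα : ∀ i, α i < e i) (hβ : ∀ i, β i < e i) (f : MvPolynomial σ ℂ) (ν : σ →₀ ℕ) :
    coeff (scaleExponent e ν + β) (expandVars e f * monomial α 1) =
      if α = β then coeff ν f else 0 := by
  induction f using MvPolynomial.induction_on' with
  | monomial μ r =>
    rw [expandVars_monomial, monomial_mul, mul_one, coeff_monomial, coeff_monomial]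
    simp only [scaleExponent_add_eq_iff hα hβ]
    split_ifs <;> simp_all
  | add p q hp hq =>
    rw [map_add, add_mul, coeff_add, hp, hq]
    split_ifs <;> simp

theorem eq_zero_of_sum_expandVars_mul_monomial_eq_zero {e : σ → ℕ} {T : Finset (σ →₀ ℕ)}
    (hT : ∀ α ∈ T, ∀ i, α i < e i) {F : (σ →₀ ℕ) → MvPolynomial σ ℂ}
    (h : ∑ α ∈ T, expandVars e (F α) * monomial α 1 = 0) {α : σ →₀ ℕ} (hα : α ∈ T) : F α = 0 := by
  classical
  ext ν
  have := congr_arg (coeff (scaleExponent e ν + α)) h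
  rw [coeff_sum, Finset.sum_congr rfl fun β hβ ↦
    coeff_expandVars_mul_monomial (hT β hβ) (hT α hα) (F β) ν] at this
  simpa [hα] using this

theorem exists_eq_scaleExponent_add {e : σ → ℕ} (he : ∀ i, 0 < e i) (ν : σ →₀ ℕ) :
    ∃ μ α : σ →₀ ℕ, ν = scaleExponent e μ + α ∧ ∀ i, α i < e i := by
  refine ⟨Finsupp.equivFunOnFinite.symm fun i ↦ ν i / e i,
    Finsupp.equivFunOnFinite.symm fun i ↦ ν i % e i, ?_, fun i ↦ Nat.mod_lt _ (he i)⟩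
  ext i
  exact (Nat.div_add_mod _ _).symm

theorem weight_scaleExponent {a : σ → ℤ} {N : ℕ} {e : σ → ℕ} {w : σ → ℕ × ℕ}
    (h : ∀ i, (e i : ℤ) * a i = N * bidegreeDiff (w i)) (μ : σ →₀ ℕ) :
    Finsupp.weight a (scaleExponent e μ) = N * bidegreeDiff (Finsupp.weight w μ) := by
  rw [Finsupp.weight_eq_sum, Finsupp.weight_eq_sum, map_sum, Finset.mul_sum]
  refine Finset.sum_congr rfl fun i _ ↦ ?_
  rw [scaleExponent_apply, map_nsmul, nsmul_eq_mul, nsmul_eq_mul, mul_left_comm, ← h]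
  push_cast
  ring

theorem IsWeightedHomogeneous.expandVars {a : σ → ℤ} {N : ℕ} {e : σ → ℕ} {w : σ → ℕ × ℕ}
    (h : ∀ i, (e i : ℤ) * a i = N * bidegreeDiff (w i)) {f : MvPolynomial σ ℂ} {m : ℕ × ℕ}
    (hf : IsWeightedHomogeneous w f m) :
    IsWeightedHomogeneous a (expandVars e f) (N * bidegreeDiff m) := by
  rw [f.as_sum, map_sum]
  refine Submodule.sum_mem (weightedHomogeneousSubmodule ℂ a _) fun ν hν ↦ ?_
  rw [expandVars_monomial]
  refine isWeightedHomogeneous_monomial _ _ _ ?_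
  rw [weight_scaleExponent h, hf (mem_support_iff.1 hν)]

end expand

theorem exists_finite_free_degreeZeroSubring {n : ℕ} {a : Fin n → ℤ} {N : ℕ} (hN : N ≠ 0)
    {e : Fin n → ℕ} (he : ∀ i, 0 < e i) {w : Fin n → ℕ × ℕ}
    (hea : ∀ i, (e i : ℤ) * a i = N * bidegreeDiff (w i)) {τ : Type} {wτ : τ → ℕ × ℕ}
    {Θ : τ → MvPolynomial (Fin n) ℂ} (hΘ : ∀ t, IsWeightedHomogeneous w (Θ t) (wτ t))
    (hwτ : ∀ t, bidegreeDiff (wτ t) = 0)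
    (hB : ∀ α : Fin n →₀ ℕ, (∀ i, α i < e i) → ∀ c : ℤ, Finsupp.weight a α + N * c = 0 →
      ∃ B, IsMonomialBasis w wτ Θ Set.univ Set.univ c B) :
    ∃ _ : Algebra (MvPolynomial τ ℂ) (degreeZeroSubring n a),
      Module.Finite (MvPolynomial τ ℂ) (degreeZeroSubring n a) ∧
        Module.Free (MvPolynomial τ ℂ) (degreeZeroSubring n a) := by
  classical
  have hmem : ∀ x, x ∈ degreeZeroSubring n a ↔ IsWeightedHomogeneous a x 0 := fun x ↦ Iff.rfl
  have hΘ0 : ∀ t, expandVars e (Θ t) ∈ degreeZeroSubring n a := fun t ↦ by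
    rw [hmem]
    simpa [hwτ] using (hΘ t).expandVars hea
  let φ : MvPolynomial τ ℂ →ₐ[ℂ] degreeZeroSubring n a := aeval fun t ↦ ⟨_, hΘ0 t⟩
  have hφ : ∀ f, (φ f : MvPolynomial (Fin n) ℂ) = expandVars e (aeval Θ f) := by
    intro f
    suffices (degreeZeroSubring n a).val.comp φ = (expandVars e).comp (aeval Θ) from
      DFunLike.congr_fun this f
    exact algHom_ext fun t ↦ by simp [φ]
  let := φ.toRingHom.toAlgebra
  have hsmul : ∀ (f : MvPolynomial τ ℂ) (x : degreeZeroSubring n a),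
      ((f • x : degreeZeroSubring n a) : MvPolynomial (Fin n) ℂ) =
        expandVars e (aeval Θ f) * x := fun f x ↦ by
    rw [← hφ]; rfl
  have : IsScalarTower ℂ (MvPolynomial τ ℂ) (degreeZeroSubring n a) :=
    IsScalarTower.of_algebraMap_eq fun r ↦ (φ.commutes r).symm
  have hdiv : ∀ α : Fin n →₀ ℕ, (∀ i, α i < e i) → (N : ℤ) ∣ Finsupp.weight a α →
      ∃ B, ∃ c : ℤ, Finsupp.weight a α + N * c = 0 ∧
        IsMonomialBasis w wτ Θ Set.univ Set.univ c B := by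
    rintro α hα ⟨c, hc⟩
    have hc' : Finsupp.weight a α + N * -c = 0 := by rw [hc]; ring
    obtain ⟨B, hB⟩ := hB α hα _ hc'
    exact ⟨B, _, hc', hB⟩
  choose! B c hc hB using hdiv
  let T : Finset (Fin n →₀ ℕ) := ((Fintype.piFinset fun i ↦ Finset.range (e i)).map
    Finsupp.equivFunOnFinite.symm.toEmbedding).filter fun α ↦ (N : ℤ) ∣ Finsupp.weight a α
  have hT : ∀ α, α ∈ T ↔ (∀ i, α i < e i) ∧ (N : ℤ) ∣ Finsupp.weight a α := by
    intro α
    simp [T]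
  let K : Finset (Σ _ : Fin n →₀ ℕ, Fin n →₀ ℕ) := T.sigma B
  have hK : ∀ x : K, expandVars e (monomial x.1.2 1) * monomial x.1.1 1 ∈
      degreeZeroSubring n a := by
    rintro ⟨⟨α, b⟩, hx⟩
    obtain ⟨hα, hb⟩ := Finset.mem_sigma.1 hx
    dsimp only at hα hb ⊢
    obtain ⟨hα, hαN⟩ := (hT α).1 hα
    rw [hmem, expandVars_monomial, monomial_mul]
    refine isWeightedHomogeneous_monomial _ _ _ ?_
    rw [map_add, weight_scaleExponent hea, (hB α hα hαN).bidegreeDiff_eq b hb, add_comm,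
      hc α hα hαN]
  let v : K → degreeZeroSubring n a := fun x ↦ ⟨_, hK x⟩
  have hli : LinearIndependent (MvPolynomial τ ℂ) v := by
    rw [Fintype.linearIndependent_iff]
    intro g hg
    set G : (Fin n →₀ ℕ) → (Fin n →₀ ℕ) → MvPolynomial τ ℂ :=
      fun α b ↦ if h : ⟨α, b⟩ ∈ K then g ⟨⟨α, b⟩, h⟩ else 0 with hG
    have hgG : ∀ x : K, g x = G x.1.1 x.1.2 := fun x ↦ by simp [hG]
    have hsum : ∑ α ∈ T, expandVars e (∑ b ∈ B α, killOutside Set.univ (aeval Θ (G α b)) *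
        monomial b 1) * monomial α 1 = 0 := by
      have := congr_arg (degreeZeroSubring n a).val hg
      rw [map_sum, map_zero] at this
      simp_rw [map_sum, Finset.sum_mul]
      rw [Finset.sum_sigma', ← Finset.sum_coe_sort, ← this]
      refine Finset.sum_congr rfl fun x _ ↦ ?_
      rw [hgG, Subalgebra.coe_val, hsmul, map_mul, mul_assoc, killOutside_univ]
      rfl
    rintro ⟨⟨α, b⟩, hx⟩
    obtain ⟨hα, hb⟩ := Finset.mem_sigma.1 hx
    obtain ⟨hα', hαN⟩ := (hT α).1 hα
    have := (hB α hα' hαN).killOutside_eq_zero (G α)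
      (eq_zero_of_sum_expandVars_mul_monomial_eq_zero (fun β hβ ↦ ((hT β).1 hβ).1) hsum hα) b hb
    rwa [hgG, ← AlgHom.id_apply (R := ℂ) (G _ _), ← killOutside_univ]
  have hspan : ⊤ ≤ Submodule.span (MvPolynomial τ ℂ) (Set.range v) := by
    set L : Submodule ℂ (MvPolynomial (Fin n) ℂ) :=
      ((Submodule.span (MvPolynomial τ ℂ) (Set.range v)).restrictScalars ℂ).map
        (degreeZeroSubring n a).val.toLinearMap with hL
    suffices hmon : ∀ ν, Finsupp.weight a ν = 0 → monomial ν 1 ∈ L by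
      intro x _
      have hx : x.1 ∈ L := by
        refine mem_of_forall_monomial_mem (V := Set.univ) (S := ∅) ((hmem _).1 x.2)
          (by rw [killOutside_univ]; rfl) (by simp) L fun ν _ _ hν ↦ hmon ν hν
      obtain ⟨y, hy, hyx⟩ := hx
      rwa [← Subtype.ext hyx]
    intro ν hν
    obtain ⟨μ, α, rfl, hα⟩ := exists_eq_scaleExponent_add he ν
    rw [map_add, weight_scaleExponent hea] at hν
    have hαN : (N : ℤ) ∣ Finsupp.weight a α := ⟨-bidegreeDiff (Finsupp.weight w μ), by linarith⟩
    have hμc : bidegreeDiff (Finsupp.weight w μ) = c α := by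
      have := hc α hα hαN
      refine mul_left_cancel₀ (Int.natCast_ne_zero.2 hN) ?_
      linarith
    have hmem' : monomial μ 1 ∈ L.comap
        ((LinearMap.mulRight ℂ (monomial α (1 : ℂ))).comp (expandVars e).toLinearMap) := by
      rw [← one_mul (monomial μ _)]
      refine mul_mem_of_mem_bidegreeSpan _ (fun b hb d _ ↦ ?_)
        ((hB α hα hαN).monomial_mem μ (Set.subset_univ _) hμc)
      rw [Submodule.mem_comap, one_mul, killOutside_univ]
      refine ⟨(monomial d 1 : MvPolynomial τ ℂ) •
        v ⟨⟨α, b⟩, Finset.mem_sigma.2 ⟨(hT α).2 ⟨hα, hαN⟩, hb⟩⟩,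
        Submodule.smul_mem _ _ (Submodule.subset_span (Set.mem_range_self _)), ?_⟩
      refine (hsmul _ _).trans ?_
      simp [v, mul_assoc]
    simpa [expandVars_monomial, monomial_mul] using hmem'
  let basis := Module.Basis.mk hli hspan
  exact ⟨inferInstance, Module.Finite.of_basis basis, Module.Free.of_basis basis⟩

/-- The bidegree recording the sign of an integer. -/
def signBidegree (a : ℤ) : ℕ × ℕ :=
  if 0 < a then (1, 0) else if a < 0 then (0, 1) else 0

theorem signBidegree_eq (a : ℤ) :
    signBidegree a = 0 ∨ signBidegree a = (1, 0) ∨ signBidegree a = (0, 1) := by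
  unfold signBidegree
  split_ifs <;> simp

theorem signBidegree_eq_one_zero {a : ℤ} : signBidegree a = (1, 0) ↔ 0 < a := by
  unfold signBidegree
  split_ifs <;> simp_all [Prod.ext_iff]

theorem signBidegree_eq_zero_one {a : ℤ} : signBidegree a = (0, 1) ↔ a < 0 := by
  unfold signBidegree
  split_ifs <;> simp_all [Prod.ext_iff]
  omega

theorem bidegreeDiff_signBidegree (a : ℤ) : bidegreeDiff (signBidegree a) = a.sign := by
  unfold signBidegree
  split_ifs with h₁ h₂
  · simp [bidegreeDiff_apply, Int.sign_eq_one_of_pos h₁]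
  · simp [bidegreeDiff_apply, Int.sign_eq_neg_one_of_neg h₂]
  · obtain rfl : a = 0 := by omega
    simp [bidegreeDiff_apply]

/-- An enumeration of the positive and of the negative entries of `a`. -/
theorem exists_enumeration {n : ℕ} (a : Fin n → ℤ) : ∃ r : Fin n → ℕ,
    (∀ i j, signBidegree (a i) = signBidegree (a j) → signBidegree (a i) ≠ 0 → r i = r j → i = j) ∧
    (∀ i, 0 < a i → r i < Fintype.card {i // 0 < a i}) ∧
    (∀ i, a i < 0 → r i < Fintype.card {i // a i < 0}) ∧
    (∀ k < Fintype.card {i // 0 < a i}, ∃ u, signBidegree (a u) = (1, 0) ∧ r u = k) ∧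
    ∀ k < Fintype.card {i // a i < 0}, ∃ v, signBidegree (a v) = (0, 1) ∧ r v = k := by
  let f := Fintype.equivFin {i // 0 < a i}
  let g := Fintype.equivFin {i // a i < 0}
  let r : Fin n → ℕ := fun i ↦
    if h : 0 < a i then f ⟨i, h⟩ else if h' : a i < 0 then g ⟨i, h'⟩ else 0
  have hf : ∀ i (h : 0 < a i), r i = f ⟨i, h⟩ := fun i h ↦ by simp [r, h]
  have hg : ∀ i (h : a i < 0), r i = g ⟨i, h⟩ := fun i h ↦ by simp [r, h, h.le]
  refine ⟨r, fun i j hij hi h ↦ ?_, fun i h ↦ hf i h ▸ Fin.is_lt _, fun i h ↦ hg i h ▸ Fin.is_lt _,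
    fun k hk ↦ ?_, fun k hk ↦ ?_⟩
  · obtain h0 | h1 | h1 := signBidegree_eq (a i)
    · exact absurd h0 hi
    · rw [hf i (signBidegree_eq_one_zero.1 h1), hf j (signBidegree_eq_one_zero.1 (hij ▸ h1))] at h
      simpa using f.injective (Fin.ext h)
    · rw [hg i (signBidegree_eq_zero_one.1 h1), hg j (signBidegree_eq_zero_one.1 (hij ▸ h1))] at h
      simpa using g.injective (Fin.ext h)
  · refine ⟨f.symm ⟨k, hk⟩, signBidegree_eq_one_zero.2 (f.symm ⟨k, hk⟩).2, ?_⟩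
    rw [hf _ (f.symm ⟨k, hk⟩).2]
    simp
  · refine ⟨g.symm ⟨k, hk⟩, signBidegree_eq_zero_one.2 (g.symm ⟨k, hk⟩).2, ?_⟩
    rw [hg _ (g.symm ⟨k, hk⟩).2]
    simp

theorem exists_mul_eq_mul_sign {ι : Type*} [Fintype ι] (a : ι → ℤ) :
    ∃ N : ℕ, N ≠ 0 ∧ ∃ e : ι → ℕ, (∀ i, 0 < e i) ∧ ∀ i, (e i : ℤ) * a i = N * (a i).sign := by
  classical
  let m : ι → ℕ := fun i ↦ if a i = 0 then 1 else (a i).natAbs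
  have hm : ∀ i, 0 < m i := fun i ↦ by
    simp only [m]
    split_ifs <;> omega
  refine ⟨∏ i, m i, (Finset.prod_pos fun i _ ↦ hm i).ne', fun i ↦ ∏ j ∈ Finset.univ.erase i, m j,
    fun i ↦ Finset.prod_pos fun j _ ↦ hm j, fun i ↦ ?_⟩
  rw [← Finset.prod_erase_mul _ _ (Finset.mem_univ i), Nat.cast_mul, mul_assoc]
  congr 1
  by_cases h : a i = 0
  · simp [h]
  · simpa [m, h] using (by rw [mul_comm]; exact (Int.sign_mul_abs _).symm)

/-- The degree of an exponent with entries less than `e i` is less than the sum of the degrees of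
the `X i ^ e i` of positive degree. -/
theorem weight_lt_mul_card {n : ℕ} {a : Fin n → ℤ} {N : ℕ} {e : Fin n → ℕ}
    (hea : ∀ i, (e i : ℤ) * a i = N * (a i).sign) (hpos : ∃ j, 0 < a j) {α : Fin n →₀ ℕ}
    (hα : ∀ i, α i < e i) : Finsupp.weight a α < N * Fintype.card {i // 0 < a i} := by
  rw [Finsupp.weight_eq_sum, Fintype.card_subtype, ← nsmul_eq_mul', ← Finset.sum_const,
    Finset.sum_filter]
  have h : ∀ i, 0 < a i → α i • a i < N := fun i hi ↦ by
    have := hea i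
    rw [Int.sign_eq_one_of_pos hi, mul_one] at this
    rw [nsmul_eq_mul, ← this]
    exact mul_lt_mul_of_pos_right (by exact_mod_cast hα i) hi
  obtain ⟨j, hj⟩ := hpos
  refine Finset.sum_lt_sum (fun i _ ↦ ?_) ⟨j, Finset.mem_univ j, by simpa [hj] using h j hj⟩
  split_ifs with hi
  · exact (h i hi).le
  · exact smul_nonpos_of_nonneg_of_nonpos (Nat.zero_le _) (not_lt.1 hi)

end MvPolynomial

/-- If the weights `a₁, …, aₙ` take both a strictly positive and a strictly negative
value, then the degree-zero subring `R₀` of the weighted-graded polynomial ring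
`ℂ[x₁, …, xₙ]` is Noetherian and Cohen–Macaulay: for every prime ideal `p` of `R₀`, the
localization `(R₀)_p` is a Cohen–Macaulay local ring. -/
theorem degreeZeroSubring_noetherian_and_cohenMacaulay (n : ℕ) (hn : 1 ≤ n)
    (a : Fin n → ℤ) (hpos : ∃ j, 0 < a j) (hneg : ∃ k, a k < 0) :
    IsNoetherianRing (degreeZeroSubring n a) ∧
      ∀ p : PrimeSpectrum (degreeZeroSubring n a),
        IsCohenMacaulayLocalRing (Localization.AtPrime p.asIdeal) := by
  obtain ⟨N, hN, e, he, hea⟩ := exists_mul_eq_mul_sign a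
  obtain ⟨r, hr, hrp, hrq, hp, hq⟩ := exists_enumeration a
  set p := Fintype.card {i // 0 < a i}
  set q := Fintype.card {i // a i < 0}
  let w : Fin n → ℕ × ℕ := fun i ↦ signBidegree (a i)
  have hV : initialVars w r p q = Set.univ := Set.eq_univ_of_forall fun i ↦
    ⟨fun hi ↦ hrp i (signBidegree_eq_one_zero.1 hi), fun hi ↦ hrq i (signBidegree_eq_zero_one.1 hi)⟩
  have hD : initialIndices w (p + q - 1) (p + q - 1) = Set.univ :=
    Set.eq_univ_of_forall fun t k _ ↦ k.is_lt
  obtain ⟨h, hfin, hfree⟩ := exists_finite_free_degreeZeroSubring hN he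
    (w := w) (wτ := antidiagonalBidegree w (p + q - 1)) (Θ := antidiagonalSums w r (p + q - 1))
    (fun i ↦ by rw [hea, bidegreeDiff_signBidegree]) isWeightedHomogeneous_antidiagonalSums
    (by rintro (z | k) <;> simp [antidiagonalBidegree, bidegreeDiff_apply])
    (fun α hα c hc ↦ by
      have h₁ := weight_lt_mul_card hea hpos hα
      have h₂ := weight_lt_mul_card (a := fun i ↦ -a i) (e := e) (N := N)
        (fun i ↦ by rw [Int.sign_neg, mul_neg, hea, mul_neg])
        (hneg.imp fun _ ↦ Int.neg_pos_of_neg) hα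
      have hneg_card : Fintype.card {i // 0 < -a i} = q :=
        Fintype.card_congr (Equiv.subtypeEquivRight fun i ↦ Int.neg_pos)
      have hneg_weight : Finsupp.weight (fun i ↦ -a i) α = -Finsupp.weight a α := by
        simp [Finsupp.weight_eq_sum]
      rw [hneg_card, hneg_weight] at h₂
      have hN' : (0 : ℤ) < N := by omega
      rw [← hV, ← hD]
      exact exists_isMonomialBasis (fun i ↦ signBidegree_eq (a i)) hr hp hq (by omega)
        (lt_of_mul_lt_mul_left (by linarith) hN'.le) (lt_of_mul_lt_mul_left (by linarith) hN'.le))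
  let S := MvPolynomial ({z : Fin n // w z = 0} ⊕ Fin (p + q - 1)) ℂ
  exact ⟨IsNoetherianRing.of_finite S _, fun P ↦
    isCohenMacaulayLocalRing_of_finite_of_flat S P.asIdeal⟩
end
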